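/- arXiv:2511.22140 — 3 statements merged into one kernel-verified Lean document; each statement's English description precedes it below -/
import Mathlib

section
/- In every acyclic r-rooted digraph D = (V,E) (possibly infinite) that does not contain backward-infinite paths, every flame of D extends to a large flame of D, i.e., for every flame F ⊆ E there is a large flame L ⊆ E with F ⊆ L. -/
/-- A digraph on vertex type `V` with edge type `E` (parallel edges allowed, no loops). -/
structure MultiDigraph (V : Type*) (E : Type*) where
  tail : E → V
  head : E → V
  no_loops : ∀ e, tail e ≠ head e

namespace MultiDigraph

variable {V E : Type*}

/-- `p` is a (finite) directed path from `s` to `t` in the spanning subdigraph `D(L)`,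
identified with its list of edges (consecutive edges are incident, visited vertices
are pairwise distinct). -/
def IsPathIn (D : MultiDigraph V E) (L : Set E) (s t : V) (p : List E) : Prop :=
  ∃ hne : p ≠ [],
    D.tail (p.head hne) = s ∧
    D.head (p.getLast hne) = t ∧
    p.Chain' (fun e f => D.head e = D.tail f) ∧
    (s :: p.map D.head).Nodup ∧
    ∀ e ∈ p, e ∈ L

/-- `δ_{D(L)}(v)`: the set of ingoing edges of `v` lying in `L`. -/
def delta (D : MultiDigraph V E) (L : Set E) (v : V) : Set E :=
  {e | e ∈ L ∧ D.head e = v}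

/-- `δ_{D(L)}(X)`: the set of edges of `D(L)` entering the vertex set `X`
(tail outside `X`, head inside `X`). -/
def edgesInto (D : MultiDigraph V E) (L : Set E) (X : Set V) : Set E :=
  {e | e ∈ L ∧ D.tail e ∉ X ∧ D.head e ∈ X}

/-- `I ∈ 𝒢_{D(L)}(v)`: `I` is a set of ingoing edges of `v` in `D(L)` for which
there is a set of pairwise edge-disjoint `r`–`v` paths of `D(L)` covering `I`. -/
def MemGv (D : MultiDigraph V E) (L : Set E) (r v : V) (I : Set E) : Prop :=
  I ⊆ D.delta L v ∧
  ∃ Ps : Set (List E),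
    (∀ p ∈ Ps, D.IsPathIn L r v p) ∧
    Ps.Pairwise (fun p q => p.Disjoint q) ∧
    ∀ e ∈ I, ∃ p ∈ Ps, e ∈ p

/-- `L' ∈ 𝒢(D(L))`: `L'` is a union `⋃_{v ≠ r} I_v` with `I_v ∈ 𝒢_{D(L)}(v)`;
equivalently, every edge of `L'` has head distinct from `r` and for each `v ≠ r`
the set of ingoing edges of `v` in `L'` belongs to `𝒢_{D(L)}(v)`. -/
def MemG (D : MultiDigraph V E) (L : Set E) (r : V) (L' : Set E) : Prop :=
  L' ⊆ L ∧ (∀ e ∈ L', D.head e ≠ r) ∧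
    ∀ v, v ≠ r → D.MemGv L r v (D.delta L' v)

/-- `F` is a flame: `F ∈ 𝒢(D(F))`. -/
def IsFlame (D : MultiDigraph V E) (r : V) (F : Set E) : Prop :=
  D.MemG F r F

/-- `C` is a transversal of the set `Ps` of paths: `C` consists of exactly one
edge from each path in `Ps`. -/
def IsTransversal (Ps : Set (List E)) (C : Set E) : Prop :=
  (∀ p ∈ Ps, ∃! e, e ∈ C ∧ e ∈ p) ∧ ∀ e ∈ C, ∃ p ∈ Ps, e ∈ p

/-- `C` is an `s`–`t` cut in `D(L)`: every `s`–`t` path of `D(L)` meets `C`. -/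
def IsCut (D : MultiDigraph V E) (L : Set E) (s t : V) (C : Set E) : Prop :=
  ∀ p, D.IsPathIn L s t p → ∃ e ∈ p, e ∈ C

/-- `L` is large at `v`: `D(L)` admits a set `Ps` of pairwise edge-disjoint
`r`–`v` paths together with a transversal of `Ps` that is an `r`–`v` cut in `D`. -/
def LargeAt (D : MultiDigraph V E) (r v : V) (L : Set E) : Prop :=
  ∃ (Ps : Set (List E)) (C : Set E),
    (∀ p ∈ Ps, D.IsPathIn L r v p) ∧
    Ps.Pairwise (fun p q => p.Disjoint q) ∧
    IsTransversal Ps C ∧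
    D.IsCut Set.univ r v C

/-- `L` is large: it is large at every `v ≠ r`. -/
def Large (D : MultiDigraph V E) (r : V) (L : Set E) : Prop :=
  ∀ v, v ≠ r → D.LargeAt r v L

/-- `D` contains a directed cycle. -/
def HasCycle (D : MultiDigraph V E) : Prop :=
  ∃ (p : List E) (hne : p ≠ []),
    p.Chain' (fun e f => D.head e = D.tail f) ∧
    D.head (p.getLast hne) = D.tail (p.head hne) ∧
    (p.map D.head).Nodup

/-- `D` contains a backward-infinite path: edges `…, f 2, f 1, f 0` (with `f 0` the
last edge, so the path has a final vertex `D.head (f 0)` but no first vertex); the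
visited vertices `D.head (f n)` are pairwise distinct. -/
def HasBackwardInfinitePath (D : MultiDigraph V E) : Prop :=
  ∃ f : ℕ → E,
    (∀ n, D.tail (f n) = D.head (f (n + 1))) ∧
    Function.Injective (fun n => D.head (f n))

/-- `X ⊆ V \ {r}` is `v`-linked in `D(L)`: `v ∈ X` and there is a family
`{P e : e ∈ δ_{D(L)}(X)}` of pairwise edge-disjoint paths of `D(L)`, where `P e`
has `e` as its initial edge and `v` as its terminal vertex. -/
def VLinked (D : MultiDigraph V E) (L : Set E) (r v : V) (X : Set V) : Prop :=
  r ∉ X ∧ v ∈ X ∧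
  ∃ P : E → List E,
    (∀ e ∈ D.edgesInto L X, D.IsPathIn L (D.tail e) v (P e) ∧ (P e).head? = some e) ∧
    (D.edgesInto L X).Pairwise (fun e f => (P e).Disjoint (P f))

/-- `p` is an `r`–`X` path in `D(L)`: a path starting at `r` meeting `X` exactly
in its last vertex. -/
def IsRXPathIn (D : MultiDigraph V E) (L : Set E) (r : V) (X : Set V) (p : List E) : Prop :=
  ∃ hne : p ≠ [],
    D.tail (p.head hne) = r ∧
    D.head (p.getLast hne) ∈ X ∧
    (∀ e ∈ p.dropLast, D.head e ∉ X) ∧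
    p.Chain' (fun e f => D.head e = D.tail f) ∧
    (r :: p.map D.head).Nodup ∧
    ∀ e ∈ p, e ∈ L

/-- `X` is fillable in `D(L)`: there is a set `Ps` of pairwise edge-disjoint
`r`–`X` paths in `D(L)` whose set of terminal edges is exactly `δ_{D(L)}(X)`. -/
def Fillable (D : MultiDigraph V E) (L : Set E) (r : V) (X : Set V) : Prop :=
  ∃ Ps : Set (List E),
    (∀ p ∈ Ps, D.IsRXPathIn L r X p) ∧
    Ps.Pairwise (fun p q => p.Disjoint q) ∧
    {e | ∃ p ∈ Ps, p.getLast? = some e} = D.edgesInto L X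

end MultiDigraph

universe u v w

theorem exists_rec_of_locallyExtendable {ι α : Type*} [Nonempty α] {lt : ι → ι → Prop}
    (wf : WellFounded lt) (Rel : ι → (ι → α) → α → Prop)
    (congr : ∀ v f g a, (∀ w, lt w v → f w = g w) → Rel v f a → Rel v g a)
    (trans : ∀ {a b c}, lt a b → lt b c → lt a c)
    (ex : ∀ v f, (∀ w, lt w v → Rel w f (f w)) → ∃ a, Rel v f a) :
    ∃ f : ι → α, ∀ v, Rel v f (f v) := by
  classical
  let step : ∀ v, (∀ w, lt w v → α) → α := fun v g =>
    let f' : ι → α := fun w => if h : lt w v then g w h else Classical.arbitrary α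
    if h : ∃ a, Rel v f' a then h.choose else Classical.arbitrary α
  let f := wf.fix step
  refine ⟨f, fun v => wf.induction (C := fun v => Rel v f (f v)) v fun v ih => ?_⟩
  let f' : ι → α := fun w => if _ : lt w v then f w else Classical.arbitrary α
  have hf' : ∀ w, lt w v → f' w = f w := fun w hw => by simp [f', hw]
  have hex : ∃ a, Rel v f' a := by
    apply ex
    intro w hw
    rw [hf' w hw]
    exact congr w f f' _ (fun t ht => (hf' t (trans ht hw)).symm) (ih w hw)
  have hfv : f v = hex.choose := by
    have : f v = step v fun w _ => f w := wf.fix_eq step v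
    rw [this]
    exact dif_pos hex
  rw [hfv]
  exact congr v f' f _ hf' hex.choose_spec

namespace Wave

open Function Set

variable {E : Type u}

/-- The set of neighbours of `P`. -/
def nbhd (N : E → Set E) (P : Set E) : Set E := {b | ∃ p ∈ P, b ∈ N p}

theorem nbhd_mono {N : E → Set E} {P Q : Set E} (h : P ⊆ Q) : nbhd N P ⊆ nbhd N Q :=
  fun _ ⟨p, hp, hb⟩ => ⟨p, h hp, hb⟩

/-- No injective sequence inside `D` is obtained by iterating `f`. -/
def Rayless (D : Set E) (f : E → E) : Prop :=
  ∀ x : ℕ → E, Injective x → (∀ n, x n ∈ D) → ¬ ∀ n, x (n + 1) = f (x n)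

theorem Rayless.false_of_eventually {D : Set E} {f : E → E} (h : Rayless D f) {x : ℕ → E}
    (hx : Injective x) (m : ℕ) (hD : ∀ n, m ≤ n → x n ∈ D)
    (hf : ∀ n, m ≤ n → x (n + 1) = f (x n)) : False := by
  refine h (fun n => x (m + n)) (fun a b hab => ?_) (fun n => hD _ (by omega))
    (fun n => hf (m + n) (by omega))
  have := hx hab
  omega

theorem Rayless.mono {D D' : Set E} {f : E → E} (h : Rayless D f) (hD : D' ⊆ D) :
    Rayless D' f :=
  fun x hx hm hf => h x hx (fun n => hD (hm n)) hf

theorem eventually_ne_of_injective {x : ℕ → E} (hx : Injective x) (b : E) :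
    ∃ m, ∀ n, m ≤ n → x n ≠ b := by
  by_cases h : ∃ k, x k = b
  · obtain ⟨k, rfl⟩ := h
    exact ⟨k + 1, fun n hn hnk => by have := hx hnk; omega⟩
  · exact ⟨0, fun n _ hn => h ⟨n, hn⟩⟩

open Classical in
theorem Rayless.update_insert {D : Set E} {f : E → E} (h : Rayless D f) (b w : E) :
    Rayless (insert b D) (update f b w) := by
  intro x hx hm hf
  obtain ⟨m, hne⟩ := eventually_ne_of_injective hx b
  refine h.false_of_eventually hx m (fun n hn => (hm n).resolve_left (hne n hn)) fun n hn => ?_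
  rw [hf n, update_of_ne (hne n hn)]

/-- `f` matches all `L`-neighbours of `P ⊆ R` into `P`, without infinite tracks. -/
structure IsWave (N : E → Set E) (R L : Set E) (P : Set E) (f : E → E) : Prop where
  sub : P ⊆ R
  maps : ∀ b ∈ L, b ∈ nbhd N P → f b ∈ P
  adj : ∀ b ∈ L, b ∈ nbhd N P → b ∈ N (f b)
  inj : InjOn f (L ∩ nbhd N P)
  rayless : Rayless (L ∩ nbhd N P) f

/-- `f` leaves the element `a` of `P` unmatched. -/
def Spare (N : E → Set E) (L P : Set E) (f : E → E) (a : E) : Prop :=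
  a ∈ P ∧ ∀ b ∈ L, b ∈ nbhd N P → f b ≠ a

/-- Some wave leaves an element unmatched. -/
def Hindered (N : E → Set E) (R L : Set E) : Prop :=
  ∃ P f a, IsWave N R L P f ∧ Spare N L P f a

variable {N : E → Set E} {R R' L L' P : Set E} {f : E → E} {a b : E}

theorem IsWave.mono (h : IsWave N R L P f) (hR : R ⊆ R') (hL : L' ⊆ L) :
    IsWave N R' L' P f where
  sub := h.sub.trans hR
  maps b hb := h.maps b (hL hb)
  adj b hb := h.adj b (hL hb)
  inj := h.inj.mono (inter_subset_inter_left _ hL)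
  rayless := h.rayless.mono (inter_subset_inter_left _ hL)

theorem Spare.mono (h : Spare N L P f a) (hL : L' ⊆ L) : Spare N L' P f a :=
  ⟨h.1, fun b hb => h.2 b (hL hb)⟩

theorem Hindered.mono (h : Hindered N R L) (hR : R ⊆ R') (hL : L' ⊆ L) : Hindered N R' L' := by
  obtain ⟨P, f, a, hw, hs⟩ := h
  exact ⟨P, f, a, hw.mono hR hL, hs.mono hL⟩

theorem IsWave.inj' (h : IsWave N R L P f) {b c : E} (hb : b ∈ L) (hbP : b ∈ nbhd N P)
    (hc : c ∈ L) (hcP : c ∈ nbhd N P) (hbc : f b = f c) : b = c :=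
  h.inj ⟨hb, hbP⟩ ⟨hc, hcP⟩ hbc

/-- The elements reachable from `a` by alternating paths, in stages. -/
def reach (N : E → Set E) (L : Set E) (f : E → E) (a : E) : ℕ → Set E
  | 0 => {a}
  | n + 1 => reach N L f a n ∪ f '' (L ∩ nbhd N (reach N L f a n))

open Classical in
theorem IsWave.exists_flip (h : IsWave N R L P f) (hs : Spare N L P f a) :
    ∃ Z ⊆ P, a ∈ Z ∧ IsWave N R L Z f ∧ ∀ z ∈ Z, ∃ f', IsWave N R L Z f' ∧ Spare N L Z f' z := by
  set Z : ℕ → Set E := reach N L f a with hZ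
  have hZsucc : ∀ n, Z (n + 1) = Z n ∪ f '' (L ∩ nbhd N (Z n)) := fun n => rfl
  have hZP : ∀ n, Z n ⊆ P := by
    intro n
    induction n with
    | zero =>
      intro x hx
      have hxa : x = a := hx
      exact hxa ▸ hs.1
    | succ n ih =>
      rw [hZsucc]
      rintro _ (hx | ⟨b, ⟨hbL, hb⟩, rfl⟩)
      · exact ih hx
      · exact h.maps b hbL (nbhd_mono ih hb)
  have hUP : (⋃ n, Z n) ⊆ P := iUnion_subset hZP
  have ha : a ∈ ⋃ n, Z n := mem_iUnion.2 ⟨0, rfl⟩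
  have hw : IsWave N R L (⋃ n, Z n) f :=
    { sub := hUP.trans h.sub
      maps := by
        rintro b hb ⟨p, hp, hbp⟩
        obtain ⟨n, hn⟩ := mem_iUnion.1 hp
        refine mem_iUnion.2 ⟨n + 1, ?_⟩
        rw [hZsucc]
        exact Or.inr ⟨b, ⟨hb, p, hn, hbp⟩, rfl⟩
      adj := fun b hb hbp => h.adj b hb (nbhd_mono hUP hbp)
      inj := h.inj.mono (inter_subset_inter_right _ (nbhd_mono hUP))
      rayless := h.rayless.mono (inter_subset_inter_right _ (nbhd_mono hUP)) }
  refine ⟨⋃ n, Z n, hUP, ha, hw, ?_⟩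
  have key : ∀ n, ∀ z ∈ Z n, ∃ f', IsWave N R L (⋃ n, Z n) f' ∧ Spare N L (⋃ n, Z n) f' z ∧
      ∀ b ∈ L, b ∈ nbhd N (⋃ n, Z n) → f b ∉ Z n → f' b = f b := by
    intro n
    induction n with
    | zero =>
      intro z hz
      have hza : z = a := hz
      rw [hza]
      exact ⟨f, hw, ⟨ha, fun b hb hbp => hs.2 b hb (nbhd_mono hUP hbp)⟩, fun _ _ _ _ => rfl⟩
    | succ n ih =>
      intro z hz
      by_cases hzn : z ∈ Z n
      · obtain ⟨f', h1, h2, h3⟩ := ih z hzn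
        exact ⟨f', h1, h2, fun b hb hbp hfb => h3 b hb hbp fun hc => hfb (Or.inl hc)⟩
      rw [hZsucc] at hz
      obtain ⟨b, ⟨hbL, w, hwn, hbw⟩, rfl⟩ := hz.resolve_left hzn
      obtain ⟨f', h1, h2, h3⟩ := ih w hwn
      have hwU : w ∈ ⋃ n, Z n := mem_iUnion.2 ⟨n, hwn⟩
      have hbU : b ∈ nbhd N (⋃ n, Z n) := ⟨w, hwU, hbw⟩
      have hfb : f' b = f b := h3 b hbL hbU hzn
      have hne : ∀ c ∈ L, c ∈ nbhd N (⋃ n, Z n) → f' c ≠ w := h2.2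
      refine ⟨update f' b w, ⟨h1.sub, ?_, ?_, ?_, ?_⟩, ⟨hw.maps b hbL hbU, ?_⟩, ?_⟩
      · intro c hc hcU
        by_cases hcb : c = b
        · subst hcb; simpa using hwU
        · rw [update_of_ne hcb]; exact h1.maps c hc hcU
      · intro c hc hcU
        by_cases hcb : c = b
        · subst hcb; simpa using hbw
        · rw [update_of_ne hcb]; exact h1.adj c hc hcU
      · rintro c ⟨hc, hcU⟩ d ⟨hd, hdU⟩ hcd
        by_cases hcb : c = b <;> by_cases hdb : d = b
        · rw [hcb, hdb]
        · subst hcb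
          rw [update_self, update_of_ne hdb] at hcd
          exact absurd hcd.symm (hne d hd hdU)
        · subst hdb
          rw [update_self, update_of_ne hcb] at hcd
          exact absurd hcd (hne c hc hcU)
        · rw [update_of_ne hcb, update_of_ne hdb] at hcd
          exact h1.inj' hc hcU hd hdU hcd
      · exact (h1.rayless.update_insert b w).mono (subset_insert _ _)
      · intro c hc hcU
        by_cases hcb : c = b
        · subst hcb
          rw [update_self]
          rintro rfl
          exact hzn hwn
        · rw [update_of_ne hcb, ← hfb]
          exact fun hcd => hcb (h1.inj' hc hcU hbL hbU hcd)
      · intro c hc hcU hfc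
        rw [hZsucc] at hfc
        have hcb : c ≠ b := by
          rintro rfl
          exact hfc (Or.inr ⟨c, ⟨hbL, w, hwn, hbw⟩, rfl⟩)
        rw [update_of_ne hcb]
        exact h3 c hc hcU fun hcn => hfc (Or.inl hcn)
  intro z hz
  obtain ⟨n, hn⟩ := mem_iUnion.1 hz
  obtain ⟨f', h1, h2, -⟩ := key n z hn
  exact ⟨f', h1, h2⟩

open Classical in
theorem IsWave.extend (h : IsWave N R L P f) (hs : Spare N L P f a) (hb : b ∈ N a) :
    IsWave N R (insert b L) P (update f b a) where
  sub := h.sub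
  maps c hc hcP := by
    by_cases hcb : c = b
    · subst hcb; simpa using hs.1
    · rw [update_of_ne hcb]; exact h.maps c (hc.resolve_left hcb) hcP
  adj c hc hcP := by
    by_cases hcb : c = b
    · subst hcb; simpa using hb
    · rw [update_of_ne hcb]; exact h.adj c (hc.resolve_left hcb) hcP
  inj := by
    rintro c ⟨hc, hcU⟩ d ⟨hd, hdU⟩ hcd
    by_cases hcb : c = b <;> by_cases hdb : d = b
    · rw [hcb, hdb]
    · subst hcb
      rw [update_self, update_of_ne hdb] at hcd
      exact absurd hcd.symm (hs.2 d (hd.resolve_left hdb) hdU)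
    · subst hdb
      rw [update_self, update_of_ne hcb] at hcd
      exact absurd hcd (hs.2 c (hc.resolve_left hcb) hcU)
    · rw [update_of_ne hcb, update_of_ne hdb] at hcd
      exact h.inj' (hc.resolve_left hcb) hcU (hd.resolve_left hdb) hdU hcd
  rayless := by
    refine (h.rayless.update_insert b a).mono ?_
    rintro c ⟨hc | hc, hcU⟩
    · exact Or.inl hc
    · exact Or.inr ⟨hc, hcU⟩

/-- Flipping a spare wave: any neighbour of the flipped set can be covered as well. -/
theorem IsWave.exists_cover (h : IsWave N R L P f) (hs : Spare N L P f a) :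
    ∃ Z ⊆ P, Spare N L Z f a ∧ IsWave N R L Z f ∧
      ∀ b ∈ nbhd N Z, ∃ f', IsWave N R (insert b L) Z f' := by
  obtain ⟨Z, hZP, ha, hw, hz⟩ := h.exists_flip hs
  refine ⟨Z, hZP, ⟨ha, fun b hb hbZ => hs.2 b hb (nbhd_mono hZP hbZ)⟩, hw, ?_⟩
  rintro b ⟨z, hzZ, hb⟩
  obtain ⟨f', h1, h2⟩ := hz z hzZ
  exact ⟨_, h1.extend h2 hb⟩

theorem exists_wave_of_hindered_diff (h : Hindered N R (L \ {b})) (hL : ¬ Hindered N R L) :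
    ∃ P f, IsWave N R L P f ∧ b ∈ nbhd N P := by
  obtain ⟨P, f, a, hw, hs⟩ := h
  obtain ⟨Z, -, ha, hwZ, hcov⟩ := hw.exists_cover hs
  by_cases hb : b ∈ L ∧ b ∈ nbhd N Z
  · obtain ⟨f', hf'⟩ := hcov b hb.2
    exact ⟨Z, f', hf'.mono subset_rfl (by intro c hc; by_cases hcb : c = b <;> simp [hcb, hc]),
      hb.2⟩
  · exfalso
    have key : ∀ c, c ∈ L → c ∈ nbhd N Z → c ∈ L \ {b} := fun c hc hcZ =>
      ⟨hc, by rintro rfl; exact hb ⟨hc, hcZ⟩⟩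
    have hsub : L ∩ nbhd N Z ⊆ L \ {b} ∩ nbhd N Z := fun c hc => ⟨key c hc.1 hc.2, hc.2⟩
    refine hL ⟨Z, f, a, ⟨hwZ.sub, fun c hc hcZ => hwZ.maps c (key c hc hcZ) hcZ,
      fun c hc hcZ => hwZ.adj c (key c hc hcZ) hcZ,
      hwZ.inj.mono hsub, hwZ.rayless.mono hsub⟩, ha.1, fun c hc hcZ => ?_⟩
    exact ha.2 c (key c hc hcZ) hcZ

end Wave

namespace Wave

open Function Set Cardinal

variable {E : Type u} {N : E → Set E} {R R' L L' P : Set E} {f : E → E} {a b : E}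

theorem exists_greatest_wave (hN : ∀ e, e ∈ N e) (R L : Set E) :
    ∃ P f, IsWave N R L P f ∧ ∀ Q g, IsWave N R L Q g → Q ⊆ P := by
  classical
  let ι := {w : Set E × (E → E) // IsWave N R L w.1 w.2}
  obtain ⟨_, _⟩ := exists_wellFoundedLT ι
  let P : Set E := ⋃ i : ι, i.1.1
  have hex : ∀ b ∈ nbhd N P, ∃ i : ι, b ∈ nbhd N i.1.1 := by
    rintro b ⟨p, hp, hb⟩
    obtain ⟨i, hi⟩ := mem_iUnion.1 hp
    exact ⟨i, p, hi, hb⟩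
  have hmin : ∀ b, ∃ i : ι, b ∈ nbhd N P → b ∈ nbhd N i.1.1 ∧ ∀ j : ι, b ∈ nbhd N j.1.1 → i ≤ j := by
    intro b
    by_cases hb : b ∈ nbhd N P
    · have hne : {i : ι | b ∈ nbhd N i.1.1}.Nonempty := hex b hb
      exact ⟨wellFounded_lt.min _ hne, fun _ => ⟨wellFounded_lt.min_mem _ hne,
        fun j hj => wellFounded_lt.min_le (s := {i : ι | b ∈ nbhd N i.1.1}) hj⟩⟩
    · exact ⟨⟨(∅, id), by constructor <;> simp [nbhd, Rayless]⟩, fun h => absurd h hb⟩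
  choose i hi using hmin
  have hadj : ∀ b ∈ L, b ∈ nbhd N P → b ∈ N ((i b).1.2 b) := fun b hb hbP =>
    (i b).2.adj b hb (hi b hbP).1
  have hmem : ∀ b ∈ L, b ∈ nbhd N P → (i b).1.2 b ∈ (i b).1.1 := fun b hb hbP =>
    (i b).2.maps b hb (hi b hbP).1
  refine ⟨P, fun b => (i b).1.2 b, ⟨iUnion_subset fun i => i.2.sub, ?_, hadj, ?_, ?_⟩,
    fun Q g h => subset_iUnion (fun i : ι => i.1.1) ⟨(Q, g), h⟩⟩
  · exact fun b hb hbP => mem_iUnion.2 ⟨i b, hmem b hb hbP⟩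
  · rintro b ⟨hb, hbP⟩ c ⟨hc, hcP⟩ hbc
    have h1 : i c ≤ i b := (hi c hcP).2 _ ⟨_, hmem b hb hbP, by
      have := hadj c hc hcP
      rwa [← show (i b).1.2 b = (i c).1.2 c from hbc] at this⟩
    have h2 : i b ≤ i c := (hi b hbP).2 _ ⟨_, hmem c hc hcP, by
      have := hadj b hb hbP
      rwa [show (i b).1.2 b = (i c).1.2 c from hbc] at this⟩
    have h3 := le_antisymm h2 h1
    have hbc' : (i b).1.2 b = (i c).1.2 c := hbc
    rw [← h3] at hbc'
    exact (i b).2.inj' hb (hi b hbP).1 hc (h3 ▸ (hi c hcP).1) hbc'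
  · intro x hx hm hf
    have hstep : ∀ n, i (x (n + 1)) ≤ i (x n) := by
      intro n
      refine (hi _ (hm (n + 1)).2).2 _ ⟨x (n + 1), ?_, hN _⟩
      rw [hf n]
      exact hmem _ (hm n).1 (hm n).2
    have hanti : Antitone fun n => i (x n) := antitone_nat_of_succ_le hstep
    obtain ⟨m, hmin⟩ : ∃ m, ∀ n, i (x m) ≤ i (x n) := by
      have hne : (range fun n => i (x n)).Nonempty := range_nonempty _
      obtain ⟨m, hm⟩ := wellFounded_lt.min_mem _ hne
      exact ⟨m, fun n => by
        have := wellFounded_lt.min_le (mem_range_self (f := fun n => i (x n)) n)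
        rw [← hm] at this
        exact this⟩
    have hconst : ∀ n, m ≤ n → i (x n) = i (x m) := fun n hn => le_antisymm (hanti hn) (hmin n)
    refine (i (x m)).2.rayless.false_of_eventually hx m (fun n hn => ⟨(hm n).1, ?_⟩) fun n hn => ?_
    · rw [← hconst n hn]; exact (hi _ (hm n).2).1
    · rw [hf n, ← hconst n hn]

theorem exists_match_one (hN : ∀ e, e ∈ N e) (h : ¬ Hindered N R L) (ha : a ∈ R) :
    ∃ b ∈ N a, b ∈ L ∧ ¬ Hindered N (R \ {a}) (L \ {b}) := by
  by_contra! hcon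
  have h' : ¬ Hindered N (R \ {a}) L := fun h' => h (h'.mono sdiff_subset subset_rfl)
  obtain ⟨P, f, hw, hmax⟩ := exists_greatest_wave hN (R \ {a}) L
  have key : L ∩ nbhd N (insert a P) ⊆ L ∩ nbhd N P := by
    rintro b ⟨hb, p, rfl | hp, hbp⟩
    · obtain ⟨Q, g, hQ, hbQ⟩ := exists_wave_of_hindered_diff (hcon b hbp hb) h'
      exact ⟨hb, nbhd_mono (hmax Q g hQ) hbQ⟩
    · exact ⟨hb, p, hp, hbp⟩
  refine h ⟨insert a P, f, a, ⟨?_, ?_, ?_, hw.inj.mono key, hw.rayless.mono key⟩,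
    mem_insert _ _, ?_⟩
  · rintro b (rfl | hb)
    · exact ha
    · exact (hw.sub hb).1
  · exact fun b hb hbP => Or.inr (hw.maps b hb (key ⟨hb, hbP⟩).2)
  · exact fun b hb hbP => hw.adj b hb (key ⟨hb, hbP⟩).2
  · rintro b hb hbP rfl
    exact (hw.sub (hw.maps b hb (key ⟨hb, hbP⟩).2)).2 rfl

/-- `g` matches `X ⊆ R` into `Y ⊆ L` and what remains is unhindered. -/
structure SafeMatching (N : E → Set E) (R L X Y : Set E) (g : E → E) : Prop where
  subR : X ⊆ R
  subL : Y ⊆ L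
  maps : MapsTo g X Y
  inj : InjOn g X
  adj : ∀ x ∈ X, g x ∈ N x
  unhindered : ¬ Hindered N (R \ X) (L \ Y)

open Classical in
theorem SafeMatching.trans {X Y X' Y' : Set E} {g g' : E → E} (h : SafeMatching N R L X Y g)
    (h' : SafeMatching N (R \ X) (L \ Y) X' Y' g') :
    SafeMatching N R L (X ∪ X') (Y ∪ Y') (X.piecewise g g') := by
  have h1 : ∀ x ∈ X, X.piecewise g g' x = g x := fun x hx => piecewise_eq_of_mem _ _ _ hx
  have h2 : ∀ x ∈ X', X.piecewise g g' x = g' x := fun x hx =>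
    piecewise_eq_of_notMem _ _ _ (h'.subR hx).2
  refine ⟨?_, ?_, ?_, ?_, ?_, ?_⟩
  · exact union_subset h.subR (h'.subR.trans sdiff_subset)
  · exact union_subset h.subL (h'.subL.trans sdiff_subset)
  · rintro x (hx | hx)
    · rw [h1 x hx]; exact Or.inl (h.maps hx)
    · rw [h2 x hx]; exact Or.inr (h'.maps hx)
  · rintro x (hx | hx) y (hy | hy) hxy
    · rw [h1 x hx, h1 y hy] at hxy; exact h.inj hx hy hxy
    · rw [h1 x hx, h2 y hy] at hxy
      exact absurd (hxy ▸ h.maps hx) (h'.subL (h'.maps hy)).2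
    · rw [h2 x hx, h1 y hy] at hxy
      exact absurd (hxy ▸ h.maps hy) (h'.subL (h'.maps hx)).2
    · rw [h2 x hx, h2 y hy] at hxy; exact h'.inj hx hy hxy
  · rintro x (hx | hx)
    · rw [h1 x hx]; exact h.adj x hx
    · rw [h2 x hx]; exact h'.adj x hx
  · rw [← sdiff_sdiff, ← sdiff_sdiff]; exact h'.unhindered

theorem SafeMatching.empty (h : ¬ Hindered N R L) : SafeMatching N R L ∅ ∅ id :=
  ⟨empty_subset _, empty_subset _, mapsTo_empty _ _, injOn_empty _, by simp, by simpa using h⟩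

theorem exists_safeMatching_finite (hN : ∀ e, e ∈ N e) (h : ¬ Hindered N R L) {Z : Set E}
    (hZ : Z.Finite) :
    ∃ X Y g, SafeMatching N R L X Y g ∧ R ∩ Z ⊆ X ∧ X.Finite ∧ Y.Finite := by
  induction Z, hZ using Set.Finite.induction_on with
  | empty => exact ⟨∅, ∅, id, SafeMatching.empty h, by simp, finite_empty, finite_empty⟩
  | @insert a Z _ _ ih =>
    obtain ⟨X, Y, g, hs, hZX, hX, hY⟩ := ih
    by_cases ha : a ∈ R \ X
    · obtain ⟨b, hab, hb, hun⟩ := exists_match_one hN hs.unhindered ha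
      have hs' : SafeMatching N (R \ X) (L \ Y) {a} {b} (fun _ => b) :=
        ⟨by simpa using ha, by simpa using hb, by simp [MapsTo], by simp, by simpa using hab, hun⟩
      refine ⟨_, _, _, hs.trans hs', ?_, hX.union (finite_singleton a),
        hY.union (finite_singleton b)⟩
      rintro c ⟨hcR, rfl | hc⟩
      · exact Or.inr rfl
      · exact Or.inl (hZX ⟨hcR, hc⟩)
    · refine ⟨X, Y, g, hs, ?_, hX, hY⟩
      rintro c ⟨hcR, rfl | hc⟩
      · by_contra hcX; exact ha ⟨hcR, hcX⟩
      · exact hZX ⟨hcR, hc⟩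

/-- `U` contains the value of `F` at each of its finite subsets. -/
def ClosedUnder (F : Finset E → Set E) (U : Set E) : Prop := ∀ x : Finset E, ↑x ⊆ U → F x ⊆ U

theorem mk_finset_subset_lt {κ : Cardinal.{u}} (hκ : ℵ₀ ≤ κ) {U : Set E} (hU : #U < κ) :
    #{x : Finset E // ↑x ⊆ U} < κ := by
  classical
  have hle : #{x : Finset E // ↑x ⊆ U} ≤ #(Finset U) := by
    refine mk_le_of_injective (f := fun x => x.1.subtype (· ∈ U)) ?_
    rintro ⟨x, hx⟩ ⟨y, hy⟩ hxy
    ext z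
    have := congrArg (fun s => s.map (Embedding.subtype _)) hxy
    simp only [Finset.subtype_map] at this
    have h2 := Finset.ext_iff.1 this z
    simp only [Finset.mem_filter] at h2
    constructor
    · exact fun hz => (h2.1 ⟨hz, hx hz⟩).1
    · exact fun hz => (h2.2 ⟨hz, hy hz⟩).1
  refine hle.trans_lt ?_
  rcases lt_or_ge (#U) ℵ₀ with h | h
  · have : Finite U := lt_aleph0_iff_finite.1 h
    exact (lt_aleph0_of_finite _).trans_le hκ
  · have : Infinite U := infinite_iff.2 h
    rwa [mk_finset_of_infinite]

theorem mk_iUnion_finset_lt {κ : Cardinal.{u}} (hκ : κ.IsRegular) {F : Finset E → Set E}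
    (hF : ∀ x, #(F x) < κ) {U : Set E} (hU : #U < κ) :
    #(⋃ x : {x : Finset E // ↑x ⊆ U}, F x.1 : Set E) < κ :=
  (card_iUnion_lt_iff_forall_of_isRegular hκ (mk_finset_subset_lt hκ.aleph0_le hU)).2
    fun x => hF x.1

theorem finset_subset_iUnion_of_monotone {ι : Type*} [SemilatticeSup ι] [Nonempty ι]
    {C : ι → Set E} (hC : Monotone C) {x : Finset E} (hx : ↑x ⊆ ⋃ n, C n) :
    ∃ n, ↑x ⊆ C n := by
  classical
  induction x using Finset.induction_on with
  | empty => exact ⟨Classical.arbitrary ι, by simp⟩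
  | insert a x _ ih =>
    rw [Finset.coe_insert, insert_subset_iff] at hx
    obtain ⟨m, hm⟩ := mem_iUnion.1 hx.1
    obtain ⟨n, hn⟩ := ih hx.2
    refine ⟨m ⊔ n, ?_⟩
    rw [Finset.coe_insert, insert_subset_iff]
    exact ⟨hC le_sup_left hm, hn.trans (hC le_sup_right)⟩

theorem mk_union_lt {κ : Cardinal.{u}} (hκ : ℵ₀ ≤ κ) {S T : Set E} (hS : #S < κ) (hT : #T < κ) :
    #(S ∪ T : Set E) < κ :=
  (mk_union_le S T).trans_lt (add_lt_of_lt hκ hS hT)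

theorem exists_closed_superset {κ : Cardinal.{u}} (hκ : κ.IsRegular) (hκ' : ℵ₀ < κ)
    {F : Finset E → Set E} (hF : ∀ x, #(F x) < κ) {U : Set E} (hU : #U < κ) :
    ∃ C, U ⊆ C ∧ #C < κ ∧ ClosedUnder F C := by
  obtain ⟨C, hC0, hC⟩ : ∃ C : ℕ → Set E, C 0 = U ∧
      ∀ n, C (n + 1) = C n ∪ ⋃ x : {x : Finset E // ↑x ⊆ C n}, F x.1 :=
    ⟨fun n => Nat.rec U (fun _ S => S ∪ ⋃ x : {x : Finset E // ↑x ⊆ S}, F x.1) n, rfl,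
      fun _ => rfl⟩
  have hmono : Monotone C := monotone_nat_of_le_succ fun n => by rw [hC]; exact subset_union_left
  have hcard : ∀ n, #(C n) < κ := by
    intro n
    induction n with
    | zero => rwa [hC0]
    | succ n ih => rw [hC]; exact mk_union_lt hκ.aleph0_le ih (mk_iUnion_finset_lt hκ hF ih)
  refine ⟨⋃ n : ULift.{u} ℕ, C n.down, subset_iUnion_of_subset ⟨0⟩ hC0.ge, ?_, ?_⟩
  · exact (card_iUnion_lt_iff_forall_of_isRegular hκ (by simpa using hκ')).2 fun n => hcard _
  · intro x hx
    obtain ⟨n, hn⟩ := finset_subset_iUnion_of_monotone (C := C) hmono (x := x) (by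
      intro z hz
      obtain ⟨m, hm⟩ := mem_iUnion.1 (hx hz)
      exact mem_iUnion.2 ⟨m.down, hm⟩)
    refine subset_iUnion_of_subset ⟨n + 1⟩ ?_
    show F x ⊆ C (n + 1)
    rw [hC]
    exact subset_union_of_subset_right
      (subset_iUnion (fun x : {x : Finset E // ↑x ⊆ C n} => F x.1) ⟨x, hn⟩) _

end Wave

namespace Wave

open Function Set Cardinal

variable {E : Type u} {N : E → Set E} {R R' L L' P : Set E} {f : E → E} {a b : E}
  {κ : Cardinal.{u}}

/-- Every small-valued operation on finite sets has a small closed set in `𝒮`. -/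
def Unavoidable (κ : Cardinal.{u}) (𝒮 : Set (Set E)) : Prop :=
  ∀ F : Finset E → Set E, (∀ x, #(F x) < κ) → ∃ U ∈ 𝒮, #U < κ ∧ ClosedUnder F U

/-- The sets `U ∋ b` such that a wave avoiding `U` can cover `b`. -/
def coverSets (N : E → Set E) (R L : Set E) (b : E) : Set (Set E) :=
  {U | b ∈ U ∧ b ∈ L ∧ ∃ P f, IsWave N (R \ U) (insert b (L \ U)) P f ∧ b ∈ nbhd N P}

/-- The elements which can be covered by waves unavoidably. -/
def popular (κ : Cardinal.{u}) (N : E → Set E) (R L : Set E) : Set E :=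
  {b | Unavoidable κ (coverSets N R L b)}

theorem ClosedUnder.mono {F F' : Finset E → Set E} {U : Set E} (h : ClosedUnder F U)
    (hF : ∀ x, F' x ⊆ F x) : ClosedUnder F' U :=
  fun x hx => (hF x).trans (h x hx)

theorem exists_closed_pair (hκ : ℵ₀ ≤ κ) {D : Set E} (hf : InjOn f D) :
    ∃ F : Finset E → Set E, (∀ x, #(F x) < κ) ∧
      ∀ U, ClosedUnder F U → ∀ x ∈ D, x ∈ U ↔ f x ∈ U := by
  refine ⟨fun x => f '' (D ∩ ↑x) ∪ (D ∩ f ⁻¹' ↑x), fun x => ?_, fun U hU x hx => ⟨fun h => ?_,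
    fun h => ?_⟩⟩
  · refine lt_of_lt_of_le ?_ hκ
    rw [lt_aleph0_iff_set_finite]
    refine ((x.finite_toSet.inter_of_right D).image f).union ?_
    refine Set.Finite.of_finite_image (f := f) (x.finite_toSet.subset ?_) (hf.mono inter_subset_left)
    rintro _ ⟨y, hy, rfl⟩
    exact hy.2
  · exact hU {x} (by simpa using h) (Or.inl ⟨x, ⟨hx, by simp⟩, rfl⟩)
  · exact hU {f x} (by simpa using h) (Or.inr ⟨hx, by simp⟩)

theorem exists_popular_closure (hκ : κ.IsRegular) :
    ∃ F : Finset E → Set E, (∀ x, #(F x) < κ) ∧ ∀ U : Set E, #U < κ → ClosedUnder F U →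
      ∀ b, U ∈ coverSets N R L b → b ∈ popular κ N R L := by
  classical
  have h : ∀ b, ∃ F : Finset E → Set E, (∀ x, #(F x) < κ) ∧
      (b ∉ popular κ N R L →
        ∀ U : Set E, U ∈ coverSets N R L b → #U < κ → ¬ ClosedUnder F U) := by
    intro b
    by_cases hb : b ∈ popular κ N R L
    · exact ⟨fun _ => ∅, fun _ => by simpa using hκ.pos, fun h => absurd hb h⟩
    · have hb' := hb
      simp only [popular, Unavoidable, mem_ofPred_eq] at hb'
      push Not at hb'
      obtain ⟨F, hF, h⟩ := hb'
      exact ⟨F, hF, fun _ => h⟩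
  choose F hF hbF using h
  refine ⟨fun x => ⋃ p : {b // b ∈ x} × {y // y ∈ x.powerset}, F p.1.1 p.2.1, fun x => ?_,
    fun U hU hcl b hb => ?_⟩
  · exact (card_iUnion_lt_iff_forall_of_isRegular hκ
      ((lt_aleph0_of_finite _).trans_le hκ.aleph0_le)).2 fun p => hF _ _
  · by_contra hbp
    refine hbF b hbp U hb hU fun y hy => ?_
    refine Subset.trans ?_ (hcl (insert b y) (by
      rw [Finset.coe_insert]; exact insert_subset hb.1 hy))
    exact subset_iUnion (fun p : {c // c ∈ insert b y} × {z // z ∈ (insert b y).powerset} =>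
      F p.1.1 p.2.1) (⟨b, Finset.mem_insert_self _ _⟩,
        ⟨y, Finset.mem_powerset.2 (Finset.subset_insert _ _)⟩)

theorem exists_wave_of_popular (hκ : κ.IsRegular) (hb : b ∈ popular κ N R L)
    {F : Finset E → Set E} (hF : ∀ x, #(F x) < κ) :
    ∃ (U : Set E) (P : Set E) (h : E → E), #U < κ ∧ ClosedUnder F U ∧ b ∈ U ∧ b ∈ L ∧
      IsWave N (R \ U) (insert b (L \ U)) P h ∧ b ∈ nbhd N P ∧
      ∀ c ∈ L, c ∈ nbhd N P → c ∈ U → c ∈ popular κ N R L := by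
  obtain ⟨G, hG, hpop⟩ := exists_popular_closure (N := N) (R := R) (L := L) hκ
  obtain ⟨U, ⟨hbU, hbL, P, h, hw, hbP⟩, hU, hcl⟩ := hb (fun x => F x ∪ G x)
    fun x => mk_union_lt hκ.aleph0_le (hF x) (hG x)
  have hb' : b ∈ insert b (L \ U) := mem_insert _ _
  have hs : Spare N (L \ U) P h (h b) := ⟨hw.maps b hb' hbP, fun c hc hcP hcb => hc.2 (by
    rwa [hw.inj' (Or.inr hc) hcP hb' hbP hcb])⟩
  obtain ⟨Z, hZP, hsZ, hwZ, hcov⟩ := (hw.mono subset_rfl (subset_insert _ _)).exists_cover hs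
  have hsub : insert b (L \ U) ∩ nbhd N Z ⊆ insert b (L \ U) ∩ nbhd N P :=
    inter_subset_inter_right _ (nbhd_mono hZP)
  have hbZ : b ∈ nbhd N Z := ⟨h b, hsZ.1, hw.adj b hb' hbP⟩
  refine ⟨U, Z, h, hU, hcl.mono fun x => subset_union_left, hbU, hbL,
    ⟨hwZ.sub, ?_, fun c hc hcZ => hw.adj c hc (nbhd_mono hZP hcZ), hw.inj.mono hsub,
      hw.rayless.mono hsub⟩, hbZ, ?_⟩
  · rintro c (rfl | hc) hcZ
    · exact hsZ.1
    · exact hwZ.maps c hc hcZ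
  · intro c hc hcZ hcU
    obtain ⟨f', hf'⟩ := hcov c hcZ
    exact hpop U hU (hcl.mono fun x => subset_union_right) c ⟨hcU, hc, Z, f', hf', hcZ⟩

/-- A partially built wave `(P, f)`: `f` is defined on `D`, and respects the small set `V`. -/
structure Stage (E : Type u) where
  P : Set E
  f : E → E
  D : Set E
  V : Set E

/-- The stage is an approximation of a wave with spare element `a`, whose uncovered neighbours are
few and belong to `Q`. -/
structure Stage.Valid (κ : Cardinal.{u}) (N : E → Set E) (R L Q : Set E) (a : E) (S : Stage E) :
    Prop where
  sub : S.P ⊆ R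
  small : #S.V < κ
  domL : S.D ⊆ L
  dom : S.D ⊆ nbhd N S.P
  uncovered : ∀ b ∈ L, b ∈ nbhd N S.P → b ∉ S.D → b ∈ S.V ∧ b ∈ Q
  idle : S.P ∩ L ⊆ S.D
  maps : ∀ b ∈ S.D, S.f b ∈ S.P
  adj : ∀ b ∈ S.D, b ∈ N (S.f b)
  inj : InjOn S.f S.D
  rayless : Rayless S.D S.f
  closed : ∀ x ∈ S.D, x ∈ S.V ↔ S.f x ∈ S.V
  spare_mem : a ∈ S.P
  spare_small : a ∈ S.V
  spare : ∀ x ∈ S.D, S.f x ≠ a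

/-- Extension of stages. -/
structure Stage.Le (S T : Stage E) : Prop where
  P : S.P ⊆ T.P
  V : S.V ⊆ T.V
  D : S.D ⊆ T.D
  f : ∀ x ∈ S.D, (x ∈ S.V ∨ x ∉ T.V) → T.f x = S.f x

namespace Stage

variable {Q : Set E} {S T U : Stage E}

theorem Le.refl (S : Stage E) : S.Le S := ⟨subset_rfl, subset_rfl, subset_rfl, fun _ _ _ => rfl⟩

theorem Le.trans (h : S.Le T) (h' : T.Le U) : S.Le U where
  P := h.P.trans h'.P
  V := h.V.trans h'.V
  D := h.D.trans h'.D
  f x hx hxV := by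
    rw [h'.f x (h.D hx) (hxV.imp (fun hx => h.V hx) id),
      h.f x hx (hxV.imp id fun hx hxT => hx (h'.V hxT))]

theorem exists_limit (hκ : κ.IsRegular) {ι : Type u} [Nonempty ι] (hι : #ι < κ)
    {S : ι → Stage E} (hS : ∀ i, (S i).Valid κ N R L Q a)
    (hch : ∀ i j, (S i).Le (S j) ∨ (S j).Le (S i)) :
    ∃ T : Stage E, T.Valid κ N R L Q a ∧ (∀ i, (S i).Le T) ∧ T.P = ⋃ i, (S i).P := by
  classical
  have hdir : ∀ i j, ∃ k, (S i).Le (S k) ∧ (S j).Le (S k) := fun i j =>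
    (hch i j).elim (fun h => ⟨j, h, Le.refl _⟩) fun h => ⟨i, Le.refl _, h⟩
  let V : Set E := ⋃ i, (S i).V
  let Good : ι → E → Prop := fun i x => x ∈ (S i).D ∧ (x ∈ (S i).V ∨ x ∉ V)
  have hVsub : ∀ i, (S i).V ⊆ V := fun i => subset_iUnion (fun i => (S i).V) i
  have hgood : ∀ x ∈ ⋃ i, (S i).D, ∃ i, Good i x := by
    intro x hx
    obtain ⟨i, hi⟩ := mem_iUnion.1 hx
    by_cases hxV : x ∈ V
    · obtain ⟨j, hj⟩ := mem_iUnion.1 hxV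
      obtain ⟨k, hik, hjk⟩ := hdir i j
      exact ⟨k, hik.D hi, Or.inl (hjk.V hj)⟩
    · exact ⟨i, hi, Or.inr hxV⟩
  have hmono : ∀ i j x, (S i).Le (S j) → Good i x → Good j x := fun i j x h hx =>
    ⟨h.D hx.1, hx.2.imp (fun hx => h.V hx) id⟩
  have hle : ∀ i j x, (S i).Le (S j) → Good i x → (S j).f x = (S i).f x := fun i j x h hx =>
    h.f x hx.1 (hx.2.imp id fun hx hxj => hx (hVsub j hxj))
  have heq : ∀ i j x, Good i x → Good j x → (S i).f x = (S j).f x := by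
    intro i j x hi hj
    obtain ⟨k, hik, hjk⟩ := hdir i j
    rw [← hle i k x hik hi, ← hle j k x hjk hj]
  obtain ⟨F, hF⟩ : ∃ F : E → E, ∀ i x, Good i x → F x = (S i).f x := by
    refine ⟨fun x => if h : ∃ i, Good i x then (S h.choose).f x else x, fun i x hi => ?_⟩
    have h : ∃ i, Good i x := ⟨i, hi⟩
    simp only [dif_pos h]
    exact heq _ _ _ h.choose_spec hi
  have hclosed : ∀ x ∈ ⋃ i, (S i).D, x ∈ V ↔ F x ∈ V := by
    intro x hx
    obtain ⟨i, hi⟩ := hgood x hx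
    constructor
    · intro hxV
      rw [hF i x hi]
      exact hVsub i (((hS i).closed x hi.1).1 (hi.2.resolve_right (not_not.2 hxV)))
    · intro hFx
      obtain ⟨j, hj⟩ := mem_iUnion.1 hFx
      obtain ⟨k, hik, hjk⟩ := hdir i j
      have hk := hmono i k x hik hi
      refine hVsub k (((hS k).closed x hk.1).2 ?_)
      rw [← hF k x hk]
      exact hjk.V hj
  refine ⟨⟨⋃ i, (S i).P, F, ⋃ i, (S i).D, V⟩, ⟨?_, ?_, ?_, ?_, ?_, ?_, ?_, ?_, ?_, ?_, ?_, ?_, ?_,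
    ?_⟩, ?_, rfl⟩
  · exact iUnion_subset fun i => (hS i).sub
  · exact (card_iUnion_lt_iff_forall_of_isRegular hκ hι).2 fun i => (hS i).small
  · exact iUnion_subset fun i => (hS i).domL
  · exact iUnion_subset fun i => (hS i).dom.trans (nbhd_mono (subset_iUnion (fun i => (S i).P) i))
  · rintro b hb ⟨p, hp, hbp⟩ hbD
    obtain ⟨i, hi⟩ := mem_iUnion.1 hp
    have := (hS i).uncovered b hb ⟨p, hi, hbp⟩ fun h => hbD (mem_iUnion.2 ⟨i, h⟩)
    exact ⟨hVsub i this.1, this.2⟩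
  · rintro b ⟨hb, hbL⟩
    obtain ⟨i, hi⟩ := mem_iUnion.1 hb
    exact mem_iUnion.2 ⟨i, (hS i).idle ⟨hi, hbL⟩⟩
  · intro b hb
    obtain ⟨i, hi⟩ := hgood b hb
    simp only [hF i b hi]
    exact mem_iUnion.2 ⟨i, (hS i).maps b hi.1⟩
  · intro b hb
    obtain ⟨i, hi⟩ := hgood b hb
    simp only [hF i b hi]
    exact (hS i).adj b hi.1
  · intro x hx y hy hxy
    obtain ⟨i, hi⟩ := hgood x hx
    obtain ⟨j, hj⟩ := hgood y hy
    obtain ⟨k, hik, hjk⟩ := hdir i j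
    have h1 := hmono i k x hik hi
    have h2 := hmono j k y hjk hj
    refine (hS k).inj h1.1 h2.1 ?_
    rw [← hF k x h1, ← hF k y h2]
    exact hxy
  · intro x hx hm hf
    obtain ⟨k, hk⟩ := hgood _ (hm 0)
    have hall : ∀ n, Good k (x n) := by
      intro n
      induction n with
      | zero => exact hk
      | succ n ih =>
        have hxn : x (n + 1) = (S k).f (x n) := (hf n).trans (hF k _ ih)
        obtain ⟨j, hj⟩ := mem_iUnion.1 (hm (n + 1))
        refine ⟨(hS k).idle ⟨?_, (hS j).domL hj⟩, ih.2.imp ?_ ?_⟩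
        · rw [hxn]; exact (hS k).maps _ ih.1
        · rw [hxn]; exact ((hS k).closed _ ih.1).1
        · intro h; rw [hf n]; exact fun h' => h ((hclosed _ (hm n)).2 h')
    exact (hS k).rayless x hx (fun n => (hall n).1) fun n => (hf n).trans (hF k _ (hall n))
  · exact hclosed
  · exact mem_iUnion.2 ⟨Classical.arbitrary ι, (hS _).spare_mem⟩
  · exact mem_iUnion.2 ⟨Classical.arbitrary ι, (hS _).spare_small⟩
  · intro x hx
    obtain ⟨i, hi⟩ := hgood x hx
    simp only [hF i x hi]
    exact (hS i).spare x hi.1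
  · exact fun i => ⟨subset_iUnion (fun i => (S i).P) i, hVsub i, subset_iUnion (fun i => (S i).D) i,
      fun x hx hxV => hF i x ⟨hx, hxV⟩⟩

theorem Valid.exists_cover (hN : ∀ e, e ∈ N e) (hκ : κ.IsRegular) (hκ' : ℵ₀ < κ)
    (hS : S.Valid κ N R L (popular κ N R L) a) (hb : b ∈ L) (hbP : b ∈ nbhd N S.P) :
    ∃ T : Stage E, T.Valid κ N R L (popular κ N R L) a ∧ S.Le T ∧ b ∈ T.D := by
  classical
  by_cases hbD : b ∈ S.D
  · exact ⟨S, hS, Le.refl S, hbD⟩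
  obtain ⟨hbV, hbQ⟩ := hS.uncovered b hb hbP hbD
  obtain ⟨F, hF, hFcl⟩ := exists_closed_pair hκ.aleph0_le hS.inj
  obtain ⟨U, P, h, hU, hUcl, hbU, -, hw, hbP', hQ⟩ := exists_wave_of_popular hκ hbQ
    (F := fun x => F x ∪ S.V) fun x => mk_union_lt hκ.aleph0_le (hF x) hS.small
  have hVU : S.V ⊆ U := by
    have := hUcl ∅ (by simp)
    exact subset_union_right.trans this
  have hUf := hFcl U (hUcl.mono fun x => subset_union_left)
  set H : Set E := insert b (L \ U) ∩ nbhd N P with hH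
  have hHL : H ⊆ L := by rintro c ⟨rfl | hc, -⟩; exacts [hb, hc.1]
  obtain ⟨G, hG, hGcl⟩ := exists_closed_pair hκ.aleph0_le hw.inj
  obtain ⟨C, hUC, hC, hCcl⟩ := exists_closed_superset hκ hκ' (F := fun x => F x ∪ G x)
    (fun x => mk_union_lt hκ.aleph0_le (hF x) (hG x)) hU
  have hCf := hFcl C (hCcl.mono fun x => subset_union_left)
  have hCh := hGcl C (hCcl.mono fun x => subset_union_right)
  have hPU : ∀ p ∈ P, p ∉ U := fun p hp => (hw.sub hp).2
  have hPH : ∀ p ∈ P, p ∈ L → p ∈ H := fun p hp hpL => ⟨Or.inr ⟨hpL, hPU p hp⟩, p, hp, hN p⟩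
  have hmapsh : ∀ x ∈ H, h x ∈ P := fun x hx => hw.maps x hx.1 hx.2
  have hadjh : ∀ x ∈ H, x ∈ N (h x) := fun x hx => hw.adj x hx.1 hx.2
  let F' : E → E := fun x => if x ∈ C then (if x ∈ H then h x else S.f x) else
    if x ∈ S.D then S.f x else h x
  have hF' : ∀ x ∈ S.D ∪ H, (x ∈ H ∧ F' x = h x) ∨ (x ∈ S.D ∧ F' x = S.f x) := by
    rintro x hx
    by_cases hxC : x ∈ C <;> by_cases hxH : x ∈ H <;> by_cases hxD : x ∈ S.D <;>
      simp [F', hxC, hxH, hxD] at hx ⊢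
  have hclosed : ∀ x ∈ S.D ∪ H, x ∈ C ↔ F' x ∈ C := by
    intro x hx
    rcases hF' x hx with ⟨h1, h2⟩ | ⟨h1, h2⟩
    · rw [h2]; exact hCh x h1
    · rw [h2]; exact hCf x h1
  have hinC : ∀ x ∈ C, x ∈ H → F' x = h x := fun x hx hxH => by simp [F', hx, hxH]
  have hinC' : ∀ x ∈ C, x ∉ H → F' x = S.f x := fun x hx hxH => by simp [F', hx, hxH]
  have hoffC : ∀ x ∉ C, x ∈ S.D → F' x = S.f x := fun x hx hxH => by simp [F', hx, hxH]
  have hoffC' : ∀ x ∉ C, x ∉ S.D → F' x = h x := fun x hx hxH => by simp [F', hx, hxH]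
  have hcross1 : ∀ x ∈ S.D, x ∉ H → ∀ y ∈ H, S.f x ≠ h y := by
    intro x hx hxH y hy hxy
    have h1 : S.f x ∉ U := by rw [hxy]; exact hPU _ (hmapsh y hy)
    have h2 : x ∉ U := fun h => h1 ((hUf x hx).1 h)
    exact hxH ⟨Or.inr ⟨hS.domL hx, h2⟩, h y, hmapsh y hy, hxy ▸ hS.adj x hx⟩
  have hcross2 : ∀ x ∈ S.D, ∀ y ∈ H, y ∉ S.D → y ∉ C → S.f x ≠ h y := by
    intro x hx y hy hyD hyC hxy
    exact hyC (hUC (hVU (hS.uncovered y (hHL hy)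
      ⟨S.f x, hS.maps x hx, hxy ▸ hadjh y hy⟩ hyD).1))
  refine ⟨⟨S.P ∪ P, F', S.D ∪ H, C⟩, ⟨?_, hC, ?_, ?_, ?_, ?_, ?_, ?_, ?_, ?_, hclosed, ?_, ?_, ?_⟩,
    ⟨subset_union_left, hVU.trans hUC, subset_union_left, ?_⟩, ?_⟩
  · exact union_subset hS.sub (hw.sub.trans sdiff_subset)
  · exact union_subset hS.domL hHL
  · exact union_subset (hS.dom.trans (nbhd_mono subset_union_left))
      (inter_subset_right.trans (nbhd_mono subset_union_right))
  · rintro c hc ⟨p, hp | hp, hcp⟩ hcD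
    · have := hS.uncovered c hc ⟨p, hp, hcp⟩ fun h => hcD (Or.inl h)
      exact ⟨hUC (hVU this.1), this.2⟩
    · have hcU : c ∈ U := by
        by_contra hcU
        exact hcD (Or.inr ⟨Or.inr ⟨hc, hcU⟩, p, hp, hcp⟩)
      exact ⟨hUC hcU, hQ c hc ⟨p, hp, hcp⟩ hcU⟩
  · rintro p ⟨hp | hp, hpL⟩
    · exact Or.inl (hS.idle ⟨hp, hpL⟩)
    · exact Or.inr (hPH p hp hpL)
  · intro x hx
    rcases hF' x hx with ⟨h1, h2⟩ | ⟨h1, h2⟩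
    · simp only [h2]; exact Or.inr (hmapsh x h1)
    · simp only [h2]; exact Or.inl (hS.maps x h1)
  · intro x hx
    rcases hF' x hx with ⟨h1, h2⟩ | ⟨h1, h2⟩
    · simp only [h2]; exact hadjh x h1
    · simp only [h2]; exact hS.adj x h1
  · intro x hx y hy hxy
    have hxy' : F' x = F' y := hxy
    have hiff : x ∈ C ↔ y ∈ C := by rw [hclosed x hx, hclosed y hy, hxy']
    by_cases hxC : x ∈ C
    · have hyC := hiff.1 hxC
      by_cases hxH : x ∈ H <;> by_cases hyH : y ∈ H
      · rw [hinC x hxC hxH, hinC y hyC hyH] at hxy'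
        exact hw.inj hxH hyH hxy'
      · rw [hinC x hxC hxH, hinC' y hyC hyH] at hxy'
        exact absurd hxy'.symm (hcross1 y (hy.resolve_right hyH) hyH x hxH)
      · rw [hinC' x hxC hxH, hinC y hyC hyH] at hxy'
        exact absurd hxy' (hcross1 x (hx.resolve_right hxH) hxH y hyH)
      · rw [hinC' x hxC hxH, hinC' y hyC hyH] at hxy'
        exact hS.inj (hx.resolve_right hxH) (hy.resolve_right hyH) hxy'
    · have hyC : y ∉ C := fun h => hxC (hiff.2 h)
      by_cases hxD : x ∈ S.D <;> by_cases hyD : y ∈ S.D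
      · rw [hoffC x hxC hxD, hoffC y hyC hyD] at hxy'
        exact hS.inj hxD hyD hxy'
      · rw [hoffC x hxC hxD, hoffC' y hyC hyD] at hxy'
        exact absurd hxy' (hcross2 x hxD y (hy.resolve_left hyD) hyD hyC)
      · rw [hoffC' x hxC hxD, hoffC y hyC hyD] at hxy'
        exact absurd hxy'.symm (hcross2 y hyD x (hx.resolve_left hxD) hxD hxC)
      · rw [hoffC' x hxC hxD, hoffC' y hyC hyD] at hxy'
        exact hw.inj (hx.resolve_left hxD) (hy.resolve_left hyD) hxy'
  · intro x hx hm hf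
    have hf' : ∀ n, x (n + 1) = F' (x n) := hf
    have hL : ∀ n, x n ∈ L := fun n => (hm n).elim (fun h => hS.domL h) fun h => hHL h
    have hiff : ∀ n, x (n + 1) ∈ C ↔ x n ∈ C := fun n => by rw [hf' n, ← hclosed _ (hm n)]
    by_cases hx0 : x 0 ∈ C
    · have hC : ∀ n, x n ∈ C := fun n => by
        induction n with
        | zero => exact hx0
        | succ n ih => exact (hiff n).2 ih
      by_cases hex : ∃ m, x m ∈ H
      · obtain ⟨m, hmH⟩ := hex
        have hall : ∀ n, m ≤ n → x n ∈ H := fun n hn => by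
          induction n, hn using Nat.le_induction with
          | base => exact hmH
          | succ n _ ih =>
            refine hPH _ ?_ (hL _)
            rw [hf' n, hinC _ (hC n) ih]
            exact hmapsh _ ih
        exact hw.rayless.false_of_eventually hx m hall fun n hn => by
          rw [hf' n, hinC _ (hC n) (hall n hn)]
      · push Not at hex
        exact hS.rayless x hx (fun n => (hm n).resolve_right (hex n)) fun n => by
          rw [hf' n, hinC' _ (hC n) (hex n)]
    · have hC : ∀ n, x n ∉ C := fun n => by
        induction n with
        | zero => exact hx0
        | succ n ih => exact fun h => ih ((hiff n).1 h)
      by_cases hex : ∃ m, x m ∈ S.D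
      · obtain ⟨m, hmH⟩ := hex
        have hall : ∀ n, m ≤ n → x n ∈ S.D := fun n hn => by
          induction n, hn using Nat.le_induction with
          | base => exact hmH
          | succ n _ ih =>
            refine hS.idle ⟨?_, hL _⟩
            rw [hf' n, hoffC _ (hC n) ih]
            exact hS.maps _ ih
        exact hS.rayless.false_of_eventually hx m hall fun n hn => by
          rw [hf' n, hoffC _ (hC n) (hall n hn)]
      · push Not at hex
        exact hw.rayless x hx (fun n => (hm n).resolve_left (hex n)) fun n => by
          rw [hf' n, hoffC' _ (hC n) (hex n)]
  · exact Or.inl hS.spare_mem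
  · exact hUC (hVU hS.spare_small)
  · intro x hx
    rcases hF' x hx with ⟨h1, h2⟩ | ⟨h1, h2⟩
    · simp only [h2]
      exact fun hxa => hPU _ (hmapsh x h1) (hxa ▸ hVU hS.spare_small)
    · simp only [h2]; exact hS.spare x h1
  · rintro x hx (hxV | hxC)
    · refine hinC' x (hUC (hVU hxV)) ?_
      rintro ⟨rfl | hxU, -⟩
      · exact hbD hx
      · exact hxU.2 (hVU hxV)
    · exact hoffC x hxC hx
  · exact Or.inr ⟨mem_insert _ _, hbP'⟩

theorem Valid.exists_cover_all (hN : ∀ e, e ∈ N e) (hκ : κ.IsRegular) (hκ' : ℵ₀ < κ)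
    (hS : S.Valid κ N R L (popular κ N R L) a) :
    ∃ T : Stage E, T.Valid κ N R L (popular κ N R L) a ∧ S.Le T ∧ L ∩ nbhd N S.P ⊆ T.D := by
  classical
  let W : Set E := {b | b ∈ L ∧ b ∈ nbhd N S.P ∧ b ∉ S.D}
  have hWV : W ⊆ S.V := fun b hb => (hS.uncovered b hb.1 hb.2.1 hb.2.2).1
  have hW : #W < κ := (mk_le_mk_of_subset hWV).trans_lt hS.small
  obtain ⟨_, _⟩ := exists_wellFoundedLT W
  have hopt : ∀ p : W → Prop, #(Option {w // p w}) < κ := fun p => by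
    rw [mk_option]
    exact add_lt_of_lt hκ.aleph0_le ((mk_subtype_le _).trans_lt hW)
      (one_lt_aleph0.trans_le hκ.aleph0_le)
  let Rel : W → (W → Stage E) → Stage E → Prop := fun w g T =>
    T.Valid κ N R L (popular κ N R L) a ∧ S.Le T ∧ (∀ u, u < w → (g u).Le T) ∧ w.1 ∈ T.D
  have hlim : ∀ (p : W → Prop) (g : W → Stage E), (∀ w, p w → Rel w g (g w)) →
      ∃ T : Stage E, T.Valid κ N R L (popular κ N R L) a ∧ S.Le T ∧ ∀ u, p u → (g u).Le T := by
    intro p g hg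
    obtain ⟨T, hT, hle, -⟩ := exists_limit hκ (hopt p)
      (S := fun o => o.elim S fun w => g w.1) (N := N) (R := R) (L := L)
      (Q := popular κ N R L) (a := a) (by
        rintro (_ | ⟨w, hw⟩)
        · exact hS
        · exact (hg w hw).1) (by
        rintro (_ | ⟨w, hw⟩) (_ | ⟨v, hv⟩)
        · exact Or.inl (Le.refl _)
        · exact Or.inl (hg v hv).2.1
        · exact Or.inr (hg w hw).2.1
        · rcases lt_trichotomy w v with h | h | h
          · exact Or.inl ((hg v hv).2.2.1 w h)
          · subst h; exact Or.inl (Le.refl _)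
          · exact Or.inr ((hg w hw).2.2.1 v h))
    exact ⟨T, hT, hle none, fun u hu => hle (some ⟨u, hu⟩)⟩
  have : Nonempty (Stage E) := ⟨S⟩
  obtain ⟨g, hg⟩ := exists_rec_of_locallyExtendable (lt := (· < · : W → W → Prop)) wellFounded_lt
    Rel (fun w f g T hfg h => ⟨h.1, h.2.1, fun u hu => hfg u hu ▸ h.2.2.1 u hu, h.2.2.2⟩)
    lt_trans (fun w g hg => by
      obtain ⟨T, hT, hST, hle⟩ := hlim (· < w) g hg
      obtain ⟨T', hT', hTT', hw⟩ := hT.exists_cover hN hκ hκ' w.2.1 (nbhd_mono hST.P w.2.2.1)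
      exact ⟨T', hT', hST.trans hTT', fun u hu => (hle u hu).trans hTT', hw⟩)
  obtain ⟨T, hT, hST, hle⟩ := hlim (fun _ => True) g fun w _ => hg w
  refine ⟨T, hT, hST, fun b hb => ?_⟩
  by_cases hbD : b ∈ S.D
  · exact hST.D hbD
  · exact (hle ⟨b, hb.1, hb.2, hbD⟩ trivial).D (hg ⟨b, hb.1, hb.2, hbD⟩).2.2.2

theorem Valid.hindered (hN : ∀ e, e ∈ N e) (hκ : κ.IsRegular) (hκ' : ℵ₀ < κ)
    (hS : S.Valid κ N R L (popular κ N R L) a) : Hindered N R L := by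
  have hstep : ∀ S : {S : Stage E // S.Valid κ N R L (popular κ N R L) a},
      ∃ T : {S : Stage E // S.Valid κ N R L (popular κ N R L) a},
        S.1.Le T.1 ∧ L ∩ nbhd N S.1.P ⊆ T.1.D := fun S =>
    let ⟨T, hT, h⟩ := S.2.exists_cover_all hN hκ hκ'
    ⟨⟨T, hT⟩, h⟩
  choose next hle hcov using hstep
  let s : ℕ → {S : Stage E // S.Valid κ N R L (popular κ N R L) a} := fun n => next^[n] ⟨S, hS⟩
  have hs : ∀ n, s (n + 1) = next (s n) := fun n => iterate_succ_apply' _ _ _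
  have hmono : ∀ m n, m ≤ n → (s m).1.Le (s n).1 := fun m n hmn => by
    induction n, hmn using Nat.le_induction with
    | base => exact Le.refl _
    | succ n _ ih => exact ih.trans (by rw [hs]; exact hle _)
  obtain ⟨T, hT, hleT, hTP⟩ := exists_limit hκ (ι := ULift.{u} ℕ) (by simpa using hκ')
    (S := fun n => (s n.down).1) (fun n => (s n.down).2) fun m n =>
      (le_total m.down n.down).imp (hmono _ _) (hmono _ _)
  have hall : L ∩ nbhd N T.P ⊆ T.D := by
    rintro b ⟨hb, p, hp, hbp⟩
    rw [hTP] at hp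
    obtain ⟨n, hn⟩ := mem_iUnion.1 hp
    refine (hleT ⟨n.down + 1⟩).D ?_
    simp only [hs]
    exact hcov _ ⟨hb, p, hn, hbp⟩
  exact ⟨T.P, T.f, a, ⟨hT.sub, fun b hb hbP => hT.maps b (hall ⟨hb, hbP⟩),
    fun b hb hbP => hT.adj b (hall ⟨hb, hbP⟩), hT.inj.mono hall, hT.rayless.mono hall⟩,
    hT.spare_mem, fun b hb hbP => hT.spare b (hall ⟨hb, hbP⟩)⟩

end Stage

/-- Removing a small set that is closed under a suitable small-valued operation keeps the pair
unhindered. -/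
theorem exists_closure_unhindered (hN : ∀ e, e ∈ N e) (hκ : κ.IsRegular) (hκ' : ℵ₀ < κ)
    (h : ¬ Hindered N R L) :
    ∃ F : Finset E → Set E, (∀ x, #(F x) < κ) ∧
      ∀ U : Set E, #U < κ → ClosedUnder F U → ¬ Hindered N (R \ U) (L \ U) := by
  by_contra! hcon
  obtain ⟨F, hF, hpop⟩ := exists_popular_closure (N := N) (R := R) (L := L) hκ
  obtain ⟨U, hU, hcl, P, f, a, hw, hs⟩ := hcon F hF
  obtain ⟨Z, -, hsZ, hwZ, hcov⟩ := hw.exists_cover hs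
  obtain ⟨G, hG, hGcl⟩ := exists_closed_pair hκ.aleph0_le hwZ.inj
  obtain ⟨C, hUC, hC, hCcl⟩ := exists_closed_superset hκ hκ' hG
    (U := U ∪ {a}) (mk_union_lt hκ.aleph0_le hU
      (by simpa using one_lt_aleph0.trans_le hκ.aleph0_le))
  refine h (Stage.Valid.hindered (a := a) (S := ⟨Z, f, (L \ U) ∩ nbhd N Z, C⟩) hN hκ hκ' ?_)
  refine ⟨hwZ.sub.trans sdiff_subset, hC, fun b hb => hb.1.1, fun b hb => hb.2, ?_, ?_,
    fun b hb => hwZ.maps b hb.1 hb.2, fun b hb => hwZ.adj b hb.1 hb.2, hwZ.inj, hwZ.rayless,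
    hGcl C hCcl, hsZ.1, hUC (Or.inr rfl), fun b hb => hsZ.2 b hb.1 hb.2⟩
  · intro b hb hbZ hbD
    have hbU : b ∈ U := by
      by_contra hbU
      exact hbD ⟨⟨hb, hbU⟩, hbZ⟩
    obtain ⟨f', hf'⟩ := hcov b hbZ
    exact ⟨hUC (Or.inl hbU), hpop U hU hcl b ⟨hbU, hb, Z, f', hf', hbZ⟩⟩
  · rintro b ⟨hb, hbL⟩
    exact ⟨⟨hbL, (hwZ.sub hb).2⟩, b, hb, hN b⟩

end Wave

namespace Wave

open Function Set Cardinal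

variable {E : Type u} {N : E → Set E} {R R' L L' P : Set E} {f : E → E} {a b : E}
  {κ : Cardinal.{u}}

/-- A matching `g : X → Y` inside the set `U`. -/
structure Link (E : Type u) where
  X : Set E
  Y : Set E
  U : Set E
  g : E → E

/-- `T` extends `S`, and matches all of `R ∩ S.U`. -/
structure Link.Le (R : Set E) (S T : Link E) : Prop where
  X : S.X ⊆ T.X
  Y : S.Y ⊆ T.Y
  U : S.U ⊆ T.U
  saturated : R ∩ S.U ⊆ T.X
  g : EqOn T.g S.g S.X

/-- The union of a chain of safe matchings is safe, provided what remains is unhindered. -/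
theorem exists_union_of_chain {I : Type v} [LinearOrder I] {S : I → Link E} {p : I → Prop}
    (hS : ∀ i, p i → SafeMatching N R L (S i).X (S i).Y (S i).g)
    (hle : ∀ i j, i < j → p i → p j → (S i).Le R (S j))
    (hYU : ∀ i, p i → (S i).Y ⊆ (S i).U)
    (h : ¬ Hindered N R L)
    (hlim : (∃ i, p i) → (∀ i, p i → ∃ j, p j ∧ i < j) →
      ¬ Hindered N (R \ ⋃ i : {i // p i}, (S i).U) (L \ ⋃ i : {i // p i}, (S i).U)) :
    ∃ g, SafeMatching N R L (⋃ i : {i // p i}, (S i).X) (⋃ i : {i // p i}, (S i).Y) g ∧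
      ∀ i, p i → EqOn g (S i).g (S i).X := by
  classical
  have hXmono : ∀ i j, i ≤ j → p i → p j → (S i).X ⊆ (S j).X := fun i j hij hi hj => by
    rcases hij.eq_or_lt with rfl | hij
    · exact subset_rfl
    · exact (hle i j hij hi hj).X
  have hYmono : ∀ i j, i ≤ j → p i → p j → (S i).Y ⊆ (S j).Y := fun i j hij hi hj => by
    rcases hij.eq_or_lt with rfl | hij
    · exact subset_rfl
    · exact (hle i j hij hi hj).Y
  have hgmono : ∀ i j, i ≤ j → p i → p j → EqOn (S j).g (S i).g (S i).X :=
    fun i j hij hi hj => by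
    rcases hij.eq_or_lt with rfl | hij
    · exact eqOn_refl _ _
    · exact (hle i j hij hi hj).g
  have hsX : ∀ i, p i → (S i).X ⊆ ⋃ i : {i // p i}, (S i).X := fun i hi =>
    subset_iUnion (fun i : {i // p i} => (S i).X) ⟨i, hi⟩
  have hsY : ∀ i, p i → (S i).Y ⊆ ⋃ i : {i // p i}, (S i).Y := fun i hi =>
    subset_iUnion (fun i : {i // p i} => (S i).Y) ⟨i, hi⟩
  have hsU : ∀ i, p i → (S i).U ⊆ ⋃ i : {i // p i}, (S i).U := fun i hi =>
    subset_iUnion (fun i : {i // p i} => (S i).U) ⟨i, hi⟩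
  obtain ⟨g, hg⟩ : ∃ g : E → E, ∀ i, p i → EqOn g (S i).g (S i).X := by
    refine ⟨fun x => if h : ∃ i, p i ∧ x ∈ (S i).X then (S h.choose).g x else x,
      fun i hi x hx => ?_⟩
    have h : ∃ i, p i ∧ x ∈ (S i).X := ⟨i, hi, hx⟩
    simp only [dif_pos h]
    rcases le_total i h.choose with hle | hle
    · exact hgmono _ _ hle hi h.choose_spec.1 hx
    · exact (hgmono _ _ hle h.choose_spec.1 hi h.choose_spec.2).symm
  refine ⟨g, ⟨iUnion_subset fun i => (hS i i.2).subR, iUnion_subset fun i => (hS i i.2).subL,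
    ?_, ?_, ?_, ?_⟩, hg⟩
  · intro x hx
    obtain ⟨⟨i, hi⟩, hx⟩ := mem_iUnion.1 hx
    rw [hg i hi hx]
    exact hsY i hi ((hS i hi).maps hx)
  · intro x hx y hy hxy
    obtain ⟨⟨i, hi⟩, hx⟩ := mem_iUnion.1 hx
    obtain ⟨⟨j, hj⟩, hy⟩ := mem_iUnion.1 hy
    rcases le_total i j with hij | hij
    · have hx' := hXmono i j hij hi hj hx
      rw [hg j hj hx', hg j hj hy] at hxy
      exact (hS j hj).inj hx' hy hxy
    · have hy' := hXmono j i hij hj hi hy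
      rw [hg i hi hx, hg i hi hy'] at hxy
      exact (hS i hi).inj hx hy' hxy
  · intro x hx
    obtain ⟨⟨i, hi⟩, hx⟩ := mem_iUnion.1 hx
    rw [hg i hi hx]
    exact (hS i hi).adj x hx
  · by_cases hne : ∃ i, p i
    · by_cases hmax : ∀ i, p i → ∃ j, p j ∧ i < j
      · refine fun hh => hlim hne hmax (hh.mono ?_ ?_)
        · rintro x ⟨hxR, hx⟩
          refine ⟨hxR, fun hxU => hx ?_⟩
          obtain ⟨⟨i, hi⟩, hxi⟩ := mem_iUnion.1 hxU
          obtain ⟨j, hj, hij⟩ := hmax i hi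
          exact hsX j hj ((hle i j hij hi hj).saturated ⟨hxR, hxi⟩)
        · rintro x ⟨hxL, hx⟩
          refine ⟨hxL, fun hxY => hx ?_⟩
          obtain ⟨⟨i, hi⟩, hxi⟩ := mem_iUnion.1 hxY
          exact hsU i hi (hYU i hi hxi)
      · push Not at hmax
        obtain ⟨m, hm, hmax⟩ := hmax
        have h1 : (⋃ i : {i // p i}, (S i).X) = (S m).X :=
          (iUnion_subset fun i : {i // p i} => hXmono i.1 m (hmax i.1 i.2) i.2 hm).antisymm (hsX m hm)
        have h2 : (⋃ i : {i // p i}, (S i).Y) = (S m).Y :=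
          (iUnion_subset fun i : {i // p i} => hYmono i.1 m (hmax i.1 i.2) i.2 hm).antisymm (hsY m hm)
        rw [h1, h2]
        exact (hS m hm).unhindered
    · have : IsEmpty {i // p i} := ⟨fun i => hne ⟨i, i.2⟩⟩
      simpa using h

theorem exists_safeMatching_of_chain {I : Type u} [LinearOrder I] [WellFoundedLT I] [NoMaxOrder I]
    [Nonempty I] {Small : I → Set E → Prop} {G : I → Finset E → Set E} {Z : Set E}
    {c : Cardinal.{u}}
    (h : ¬ Hindered N R L)
    (step : ∀ i R' L' Z', ¬ Hindered N R' L' → Small i Z' →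
      ∃ X Y g, SafeMatching N R' L' X Y g ∧ R' ∩ Z' ⊆ X ∧ Small i X ∧ Small i Y)
    (union : ∀ i A B, Small i A → Small i B → Small i (A ∪ B))
    (iUnion_lt : ∀ i (U : I → Set E), (∀ j, j < i → Small j (U j)) →
      Small i (⋃ j : {j // j < i}, U j))
    (closure : ∀ i U, Small i U → Small i (⋃ x : {x : Finset E // ↑x ⊆ U}, G i x))
    (mono : ∀ i j x, i ≤ j → G i x ⊆ G j x)
    (limit : ∀ p : I → Prop, ((∀ i, p i) ∨ ∃ i, p = (· < i)) → (∃ i, p i) →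
      (∀ i, p i → ∃ j, p j ∧ i < j) → ∃ F : Finset E → Set E,
        (∀ x, F x ⊆ ⋃ i : {i // p i}, G i x) ∧
        ∀ U : I → Set E, (∀ i, p i → Small i (U i)) → ClosedUnder F (⋃ i : {i // p i}, U i) →
          ¬ Hindered N (R \ ⋃ i : {i // p i}, U i) (L \ ⋃ i : {i // p i}, U i))
    (card : ∀ U : I → Set E, (∀ i, Small i (U i)) → #(⋃ i, U i) ≤ c)
    (hZ : ∀ z ∈ Z, ∃ i, z ∈ G i ∅) :
    ∃ X Y g, SafeMatching N R L X Y g ∧ R ∩ Z ⊆ X ∧ #X ≤ c ∧ #Y ≤ c := by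
  classical
  let Rel : I → (I → Link E) → Link E → Prop := fun i S T =>
    Small i T.U ∧ SafeMatching N R L T.X T.Y T.g ∧ T.X ⊆ T.U ∧ T.Y ⊆ T.U ∧
    (∀ j, j < i → (S j).Le R T) ∧
    (⋃ x : {x : Finset E // ↑x ⊆ ⋃ j : {j // j < i}, (S j).U}, G i x) ⊆ T.U
  have hun : ∀ (p : I → Prop) (S : I → Link E), ((∀ i, p i) ∨ ∃ i, p = (· < i)) →
      (∀ i, p i → Rel i S (S i)) →
      ∃ g, SafeMatching N R L (⋃ i : {i // p i}, (S i).X) (⋃ i : {i // p i}, (S i).Y) g ∧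
      ∀ i, p i → EqOn g (S i).g (S i).X := by
    intro p S hp hS
    refine exists_union_of_chain (fun i hi => (hS i hi).2.1)
      (fun i j hij _ hj => (hS j hj).2.2.2.2.1 i hij) (fun i hi => (hS i hi).2.2.2.1) h
      fun hne hmax => ?_
    obtain ⟨F, hF, hlim⟩ := limit p hp hne hmax
    refine hlim (fun i => (S i).U) (fun i hi => (hS i hi).1) fun x hx y hy => ?_
    have hlow : ∀ i j, i ≤ j → p j → p i := by
      rintro i j hij hj
      rcases hp with hp | ⟨k, rfl⟩
      · exact hp i
      · exact hij.trans_lt hj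
    have hmonoU : ∀ i j, i ≤ j → p j → (S i).U ⊆ (S j).U := by
      rintro i j hij hj
      rcases hij.eq_or_lt with rfl | hij
      · exact subset_rfl
      · exact ((hS j hj).2.2.2.2.1 i hij).U
    have : Nonempty {i // p i} := ⟨⟨hne.choose, hne.choose_spec⟩⟩
    let _ : SemilatticeSup {i // p i} := (inferInstance : Lattice {i // p i}).toSemilatticeSup
    obtain ⟨⟨i, hi⟩, hxi⟩ := finset_subset_iUnion_of_monotone
      (C := fun i : {i // p i} => (S i).U) (fun i j hij => hmonoU i j hij j.2) hx
    obtain ⟨⟨j, hj⟩, hyj⟩ := mem_iUnion.1 (hF x hy)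
    obtain ⟨k, hk, hijk⟩ : ∃ k, p k ∧ i ⊔ j < k :=
      hmax (i ⊔ j) (by rcases max_cases i j with h | h <;> rw [h.1] <;> assumption)
    refine mem_iUnion.2 ⟨⟨k, hk⟩, (hS k hk).2.2.2.2.2 ?_⟩
    refine mem_iUnion.2 ⟨⟨x, hxi.trans ?_⟩, mono j k x (le_sup_right.trans hijk.le) hyj⟩
    exact subset_iUnion (fun l : {l // l < k} => (S l).U) ⟨i, le_sup_left.trans_lt hijk⟩
  have : Nonempty (Link E) := ⟨⟨∅, ∅, ∅, id⟩⟩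
  obtain ⟨S, hS⟩ := exists_rec_of_locallyExtendable (lt := (· < · : I → I → Prop)) wellFounded_lt
    Rel (by
      rintro i S S' T hSS ⟨h1, h2, h3, h4, h5, h6⟩
      refine ⟨h1, h2, h3, h4, fun j hj => hSS j hj ▸ h5 j hj, ?_⟩
      have : (⋃ j : {j // j < i}, (S' j).U) = ⋃ j : {j // j < i}, (S j).U :=
        iUnion_congr fun j => by rw [hSS j j.2]
      rw [this]
      exact h6) lt_trans (by
      intro i S hS
      obtain ⟨g, hg, hgS⟩ := hun (· < i) S (Or.inr ⟨i, rfl⟩) hS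
      set W : Set E := ⋃ j : {j // j < i}, (S j).U with hW
      set X := ⋃ j : {j // j < i}, (S j).X with hX
      set Y := ⋃ j : {j // j < i}, (S j).Y with hY
      have hsW : Small i W := iUnion_lt i (fun j => (S j).U) fun j hj => (hS j hj).1
      set Z' : Set E := W ∪ ⋃ x : {x : Finset E // ↑x ⊆ W}, G i x with hZ'
      have hsZ' : Small i Z' := union i _ _ hsW (closure i W hsW)
      obtain ⟨X', Y', g', hg', hZX', hX', hY'⟩ := step i _ _ Z' hg.unhindered hsZ'
      have hXW : X ⊆ W := iUnion_mono fun j => (hS j j.2).2.2.1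
      have hYW : Y ⊆ W := iUnion_mono fun j => (hS j j.2).2.2.2.1
      refine ⟨⟨X ∪ X', Y ∪ Y', Z' ∪ (X' ∪ Y'), X.piecewise g g'⟩,
        union i _ _ hsZ' (union i _ _ hX' hY'), hg.trans hg', ?_, ?_, fun j hj => ⟨?_, ?_, ?_, ?_,
          ?_⟩, ?_⟩
      · exact union_subset ((hXW.trans subset_union_left).trans subset_union_left)
          (subset_union_left.trans subset_union_right)
      · exact union_subset ((hYW.trans subset_union_left).trans subset_union_left)
          (subset_union_right.trans subset_union_right)
      · exact (subset_iUnion (fun j : {j // j < i} => (S j).X) ⟨j, hj⟩).trans subset_union_left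
      · exact (subset_iUnion (fun j : {j // j < i} => (S j).Y) ⟨j, hj⟩).trans subset_union_left
      · exact ((subset_iUnion (fun j : {j // j < i} => (S j).U) ⟨j, hj⟩).trans
          subset_union_left).trans subset_union_left
      · rintro x ⟨hxR, hx⟩
        by_cases hxX : x ∈ X
        · exact Or.inl hxX
        · exact Or.inr (hZX' ⟨⟨hxR, hxX⟩, Or.inl (mem_iUnion.2 ⟨⟨j, hj⟩, hx⟩)⟩)
      · intro x hx
        have hxX : x ∈ X := mem_iUnion.2 ⟨⟨j, hj⟩, hx⟩
        simp only [piecewise_eq_of_mem _ _ _ hxX]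
        exact hgS j hj hx
      · exact subset_union_right.trans subset_union_left)
  obtain ⟨g, hg, -⟩ := hun (fun _ => True) S (Or.inl fun _ => trivial) fun i _ => hS i
  have hcard := card (fun i => (S i).U) fun i => (hS i).1
  refine ⟨_, _, g, hg, ?_, (mk_le_mk_of_subset ?_).trans hcard,
    (mk_le_mk_of_subset ?_).trans hcard⟩
  · rintro z ⟨hzR, hz⟩
    obtain ⟨i, hi⟩ := hZ z hz
    obtain ⟨j, hij⟩ := exists_gt i
    refine mem_iUnion.2 ⟨⟨j, trivial⟩, ((hS j).2.2.2.2.1 i hij).saturated ⟨hzR, ?_⟩⟩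
    exact (hS i).2.2.2.2.2 (mem_iUnion.2 ⟨⟨∅, by simp⟩, hi⟩)
  · exact iUnion_subset fun i => subset_iUnion_of_subset i.1 (hS i).2.2.1
  · exact iUnion_subset fun i => subset_iUnion_of_subset i.1 (hS i).2.2.2.1

end Wave

namespace Wave

open Function Set Cardinal Ordinal

variable {E : Type u} {N : E → Set E} {R R' L L' P : Set E} {f : E → E} {a b : E}
  {κ μ : Cardinal.{u}}

theorem mk_iUnion_le_of_le {ι : Type u} {F : ι → Set E} (hμ : ℵ₀ ≤ μ) (hι : #ι ≤ μ)
    (hF : ∀ i, #(F i) ≤ μ) : #(⋃ i, F i) ≤ μ :=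
  (mk_iUnion_le F).trans ((mul_le_mul' hι (ciSup_le' hF)).trans (mul_eq_self hμ).le)

/-- A set is exhausted by an increasing family of subsets of controlled cardinality. -/
theorem exists_slices (A : Set E) :
    ∃ s : Ordinal.{u} → Set E, Monotone s ∧ (∀ o, #(s o) ≤ o.card) ∧
      ∀ a ∈ A, ∃ o < (#A).ord, ∀ o', o < o' → a ∈ s o' := by
  classical
  obtain ⟨r, hr, hAr⟩ := exists_ord_eq A
  refine ⟨fun o => Subtype.val '' {a : A | typein r a < o}, ?_, ?_, ?_⟩
  · rintro o o' hoo
    exact image_mono fun a (ha : typein r a < o) => ha.trans_le hoo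
  · intro o
    refine mk_image_le.trans ?_
    have hinj : Function.Injective
        (fun a : {a : A | typein r a < o} => (Ordinal.ToType.mk ⟨typein r a.1, a.2⟩ : o.ToType)) := by
      intro a b hab
      exact Subtype.ext (typein_injective r
        (congrArg Subtype.val (Ordinal.ToType.mk.injective hab)))
    simpa using mk_le_of_injective hinj
  · intro a ha
    refine ⟨typein r ⟨a, ha⟩, ?_, fun o ho => ⟨⟨a, ha⟩, ho, rfl⟩⟩
    rw [hAr]
    exact typein_lt_type r _

theorem exists_safeMatching_of_isRegular (hN : ∀ e, e ∈ N e) (hμ : μ.IsRegular)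
    (ih : ∀ ν < μ, ℵ₀ ≤ ν → ∀ R L Z : Set E, ¬ Hindered N R L → #Z ≤ ν →
      ∃ X Y g, SafeMatching N R L X Y g ∧ R ∩ Z ⊆ X ∧ #X ≤ ν ∧ #Y ≤ ν)
    (h : ¬ Hindered N R L) {Z : Set E} (hZ : #Z ≤ μ) :
    ∃ X Y g, SafeMatching N R L X Y g ∧ R ∩ Z ⊆ X ∧ #X ≤ μ ∧ #Y ≤ μ := by
  have hμ₀ := hμ.aleph0_le
  obtain ⟨F, hF, hFcl⟩ := exists_closure_unhindered hN (isRegular_succ hμ₀)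
    (hμ₀.trans_lt (Order.lt_succ μ)) h
  obtain ⟨F', hF', hFcl'⟩ : ∃ F : Finset E → Set E, (∀ x, #(F x) < μ) ∧ (ℵ₀ < μ →
      ∀ U : Set E, #U < μ → ClosedUnder F U → ¬ Hindered N (R \ U) (L \ U)) := by
    by_cases hlt : ℵ₀ < μ
    · obtain ⟨F, hF, hFcl⟩ := exists_closure_unhindered hN hμ hlt h
      exact ⟨F, hF, fun _ => hFcl⟩
    · exact ⟨fun _ => ∅, fun _ => by simpa using hμ.pos, fun hlt' => absurd hlt' hlt⟩
  choose s hsmono hscard hs using fun x => exists_slices (F x)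
  obtain ⟨t, htmono, htcard, ht⟩ := exists_slices Z
  have : NoMaxOrder μ.ord.ToType := Cardinal.noMaxOrder hμ₀
  have : Nonempty μ.ord.ToType := by
    rw [← mk_ne_zero_iff, mk_ord_toType]
    exact hμ.pos.ne'
  have hIlt : ∀ i : μ.ord.ToType, #{j // j < i} < μ := fun i =>
    (mk_Iio_lt i (by simp)).trans_eq (mk_ord_toType μ)
  let G : μ.ord.ToType → Finset E → Set E := fun i x =>
    F' x ∪ (s x (ToType.toOrd i).1 ∪ t (ToType.toOrd i).1)
  have hocard : ∀ i : μ.ord.ToType, (ToType.toOrd i).1.card < μ := fun i =>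
    lt_ord.1 (ToType.toOrd i).2
  have hup : ∀ o < μ.ord, ∃ i : μ.ord.ToType, o < (ToType.toOrd i).1 := by
    intro o ho
    obtain ⟨i, hi⟩ := exists_gt (ToType.mk ⟨o, ho⟩ : μ.ord.ToType)
    refine ⟨i, ?_⟩
    have := ToType.mk.symm.lt_iff_lt.2 hi
    rwa [OrderIso.symm_apply_apply] at this
  refine exists_safeMatching_of_chain (I := μ.ord.ToType) (Small := fun _ U => #U < μ) (G := G) h
    ?_ (fun i A B => mk_union_lt hμ₀) ?_ ?_ ?_ ?_ ?_ ?_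
  · intro _ R' L' Z' h' hZ'
    by_cases hfin : Z'.Finite
    · obtain ⟨X, Y, g, hg, hZX, hX, hY⟩ := exists_safeMatching_finite hN h' hfin
      exact ⟨X, Y, g, hg, hZX, hX.lt_aleph0.trans_le hμ₀, hY.lt_aleph0.trans_le hμ₀⟩
    · have hinf : ℵ₀ ≤ #Z' := by
        rw [← not_lt, lt_aleph0_iff_set_finite]
        exact hfin
      obtain ⟨X, Y, g, hg, hZX, hX, hY⟩ := ih _ hZ' hinf R' L' Z' h' le_rfl
      exact ⟨X, Y, g, hg, hZX, hX.trans_lt hZ', hY.trans_lt hZ'⟩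
  · exact fun i U hU => (card_iUnion_lt_iff_forall_of_isRegular hμ (hIlt i)).2
      fun j => hU j.1 j.2
  · refine fun i U hU => mk_iUnion_finset_lt hμ (fun x => ?_) hU
    exact mk_union_lt hμ₀ (hF' x) (mk_union_lt hμ₀ ((hscard x _).trans_lt (hocard i))
      ((htcard _).trans_lt (hocard i)))
  · intro i j x hij
    have hij' : (ToType.toOrd i).1 ≤ (ToType.toOrd j).1 := ToType.mk.symm.le_iff_le.2 hij
    exact union_subset_union_right _ (union_subset_union (hsmono x hij') (htmono hij'))
  · intro p hp hne hmax
    rcases hp with hp | ⟨i, rfl⟩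
    · refine ⟨F, fun x a ha => ?_, fun U hU hcl => hFcl _ ?_ hcl⟩
      · obtain ⟨o, ho, hao⟩ := hs x a ha
        obtain ⟨i, hi⟩ := hup o (ho.trans_le (ord_le_ord.2 (Order.lt_succ_iff.1 (hF x))))
        exact mem_iUnion.2 ⟨⟨i, hp i⟩, Or.inr (Or.inl (hao _ hi))⟩
      · refine Order.lt_succ_iff.2 (mk_iUnion_le_of_le hμ₀ ?_ fun i => (hU i.1 i.2).le)
        exact (mk_subtype_le _).trans (mk_ord_toType μ).le
    · refine ⟨F', fun x a ha => ?_, fun U hU hcl => hFcl' ?_ _ ?_ hcl⟩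
      · obtain ⟨j, hj⟩ := hne
        exact mem_iUnion.2 ⟨⟨j, hj⟩, Or.inl ha⟩
      · refine hμ₀.lt_of_ne fun hμ' => ?_
        have hfin : Finite {j // j < i} := by
          rw [← lt_aleph0_iff_finite, hμ']
          exact hIlt i
        have : Nonempty {j // j < i} := ⟨⟨hne.choose, hne.choose_spec⟩⟩
        obtain ⟨m, hm⟩ := Finite.exists_max (fun j : {j // j < i} => j.1)
        obtain ⟨j, hj, hmj⟩ := hmax m.1 m.2
        exact (hm ⟨j, hj⟩).not_gt hmj
      · exact (card_iUnion_lt_iff_forall_of_isRegular hμ (hIlt i)).2 fun j => hU j.1 j.2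
  · exact fun U hU => mk_iUnion_le_of_le hμ₀ (mk_ord_toType μ).le fun i => (hU i).le
  · intro z hz
    obtain ⟨o, ho, hzo⟩ := ht z hz
    obtain ⟨i, hi⟩ := hup o (ho.trans_le (ord_le_ord.2 hZ))
    exact ⟨i, Or.inr (Or.inr (hzo _ hi))⟩

theorem exists_safeMatching_of_isSingular (hN : ∀ e, e ∈ N e) (hμ : μ.IsSingular)
    (ih : ∀ ν < μ, ℵ₀ ≤ ν → ∀ R L Z : Set E, ¬ Hindered N R L → #Z ≤ ν →
      ∃ X Y g, SafeMatching N R L X Y g ∧ R ∩ Z ⊆ X ∧ #X ≤ ν ∧ #Y ≤ ν)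
    (h : ¬ Hindered N R L) {Z : Set E} (hZ : #Z ≤ μ) :
    ∃ X Y g, SafeMatching N R L X Y g ∧ R ∩ Z ⊆ X ∧ #X ≤ μ ∧ #Y ≤ μ := by
  have hμ₀ := hμ.aleph0_le
  have : NoMaxOrder μ.ord.ToType := Cardinal.noMaxOrder hμ₀
  have : Nonempty μ.ord.ToType := by
    rw [← mk_ne_zero_iff, mk_ord_toType]
    exact hμ.pos.ne'
  obtain ⟨S, hS, hScard⟩ := Order.exists_cof_eq μ.ord.ToType
  rw [cof_toType] at hScard
  have hSμ : #S < μ := hScard ▸ hμ.cof_ord_lt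
  have : NoMaxOrder S := ⟨fun a => by
    obtain ⟨b, hb⟩ := exists_gt a.1
    obtain ⟨c, hc, hbc⟩ := hS b
    exact ⟨⟨c, hc⟩, hb.trans_le hbc⟩⟩
  have : Nonempty S := by
    obtain ⟨c, hc, -⟩ := hS (Classical.arbitrary _)
    exact ⟨⟨c, hc⟩⟩
  let ν : S → Cardinal.{u} := fun i => max (max #S ℵ₀) (ToType.toOrd i.1).1.card
  have hν : ∀ i, ν i < μ := fun i =>
    max_lt (max_lt hSμ (hμ₀.lt_of_ne fun hμ' => not_isSingular_aleph0 (hμ' ▸ hμ))) (lt_ord.1 (ToType.toOrd i.1).2)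
  have hν₀ : ∀ i, ℵ₀ ≤ ν i := fun i => (le_max_right _ _).trans (le_max_left _ _)
  have hνS : ∀ i, #S ≤ ν i := fun i => (le_max_left _ _).trans (le_max_left _ _)
  have hνmono : Monotone ν := fun i j hij =>
    max_le_max le_rfl (card_le_card (ToType.mk.symm.le_iff_le.2 hij))
  have hup : ∀ o < μ.ord, ∃ i, o < (ν i).ord := by
    intro o ho
    have h1 : Order.succ o.card < μ := hμ.isSuccLimit.succ_lt (lt_ord.1 ho)
    obtain ⟨i, hi, hoi⟩ := hS (ToType.mk ⟨(Order.succ o.card).ord, ord_lt_ord.2 h1⟩)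
    refine ⟨⟨i, hi⟩, lt_ord.2 ((Order.lt_succ _).trans_le ?_)⟩
    refine le_trans ?_ (le_max_right _ _)
    have := ToType.mk.symm.le_iff_le.2 hoi
    simp only [OrderIso.symm_apply_apply] at this
    have := card_le_card (show (Order.succ o.card).ord ≤ (ToType.toOrd i).1 from this)
    simpa using this
  let q : Option S → S → Prop := fun o j => ∀ i ∈ o, j < i
  let σ : Option S → Cardinal.{u} := fun o => ⨆ j : {j // q o j}, ν j
  have hbdd : ∀ o, BddAbove (range fun j : {j // q o j} => ν j) := fun o => bddAbove_of_small
  obtain ⟨F, hF, hFcl⟩ : ∃ F : Option S → Finset E → Set E, (∀ o x, #(F o x) ≤ σ o) ∧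
      ∀ o, (∃ j, q o j) → ∀ U : Set E, #U ≤ σ o → ClosedUnder (F o) U →
        ¬ Hindered N (R \ U) (L \ U) := by
    have : ∀ o, ∃ F : Finset E → Set E, (∀ x, #(F x) ≤ σ o) ∧
        ((∃ j, q o j) → ∀ U : Set E, #U ≤ σ o → ClosedUnder F U →
        ¬ Hindered N (R \ U) (L \ U)) := by
      intro o
      by_cases ho : ∃ j, q o j
      · obtain ⟨j, hj⟩ := ho
        have hσ : ℵ₀ ≤ σ o := (hν₀ j).trans (le_ciSup (hbdd o) ⟨j, hj⟩)
        obtain ⟨F, hF, hFcl⟩ := exists_closure_unhindered hN (isRegular_succ hσ)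
          (hσ.trans_lt (Order.lt_succ _)) h
        exact ⟨F, fun x => Order.lt_succ_iff.1 (hF x),
          fun _ U hU => hFcl U (Order.lt_succ_iff.2 hU)⟩
      · exact ⟨fun _ => ∅, fun _ => by simp, fun h => absurd h ho⟩
    choose F hF hFcl using this
    exact ⟨F, hF, hFcl⟩
  choose s hsmono hscard hs using fun o x => exists_slices (F o x)
  obtain ⟨t, htmono, htcard, ht⟩ := exists_slices Z
  let G : S → Finset E → Set E := fun i x => (⋃ o, s o x (ν i).ord) ∪ t (ν i).ord
  have hunion : ∀ i (A B : Set E), #A ≤ ν i → #B ≤ ν i → #(A ∪ B : Set E) ≤ ν i :=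
    fun i A B hA hB => (mk_union_le A B).trans (add_le_of_le (hν₀ i) hA hB)
  refine exists_safeMatching_of_chain (I := S) (Small := fun i U => #U ≤ ν i) (G := G) h
    (fun i R' L' Z' h' hZ' => ih (ν i) (hν i) (hν₀ i) R' L' Z' h' hZ') hunion ?_ ?_ ?_ ?_ ?_ ?_
  · exact fun i U hU => mk_iUnion_le_of_le (hν₀ i) ((mk_subtype_le _).trans (hνS i))
      fun j => (hU j.1 j.2).trans (hνmono j.2.le)
  · refine fun i U hU => mk_iUnion_le_of_le (hν₀ i) ?_ fun x => hunion i _ _ ?_ ?_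
    · exact Order.lt_succ_iff.1 (mk_finset_subset_lt ((hν₀ i).trans (Order.le_succ _))
        (Order.lt_succ_iff.2 hU))
    · refine mk_iUnion_le_of_le (hν₀ i) ?_ fun o => by simpa using hscard o x.1 (ν i).ord
      rw [mk_option]
      exact add_le_of_le (hν₀ i) (hνS i) (one_le_aleph0.trans (hν₀ i))
    · simpa using htcard (ν i).ord
  · intro i j x hij
    have := ord_le_ord.2 (hνmono hij)
    exact union_subset_union (iUnion_mono fun o => hsmono o x this) (htmono this)
  · intro p hp hne hmax
    obtain ⟨o, rfl⟩ : ∃ o, p = q o := by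
      rcases hp with hp | ⟨i, rfl⟩
      · exact ⟨none, funext fun i => by simp [q, hp i]⟩
      · exact ⟨some i, funext fun j => by simp only [q, Option.mem_some_iff, forall_eq']⟩
    have hne' : Nonempty {j // q o j} := ⟨⟨hne.choose, hne.choose_spec⟩⟩
    refine ⟨F o, fun x a ha => ?_, fun U hU hcl => hFcl o hne _ ?_ hcl⟩
    · obtain ⟨b, hb, hab⟩ := hs o x a ha
      obtain ⟨j, hj⟩ := exists_lt_of_lt_ciSup ((lt_ord.1 hb).trans_le (hF o x))
      exact mem_iUnion.2 ⟨j, Or.inl (mem_iUnion.2 ⟨o, hab _ (lt_ord.2 hj)⟩)⟩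
    · obtain ⟨j, hj⟩ := hne
      have hνσ : ∀ j : {j // q o j}, ν j ≤ σ o := le_ciSup (hbdd o)
      exact mk_iUnion_le_of_le ((hν₀ j).trans (hνσ ⟨j, hj⟩))
        (((mk_subtype_le _).trans (hνS j)).trans (hνσ ⟨j, hj⟩))
        fun i => (hU i.1 i.2).trans (hνσ i)
  · exact fun U hU => mk_iUnion_le_of_le hμ₀ hSμ.le fun i => (hU i).trans (hν i).le
  · intro z hz
    obtain ⟨o, ho, hzo⟩ := ht z hz
    obtain ⟨i, hi⟩ := hup o (ho.trans_le (ord_le_ord.2 hZ))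
    exact ⟨i, Or.inr (hzo _ hi)⟩

theorem exists_safeMatching (hN : ∀ e, e ∈ N e) (μ : Cardinal.{u}) (hμ : ℵ₀ ≤ μ) (R L Z : Set E)
    (h : ¬ Hindered N R L) (hZ : #Z ≤ μ) :
    ∃ X Y g, SafeMatching N R L X Y g ∧ R ∩ Z ⊆ X ∧ #X ≤ μ ∧ #Y ≤ μ := by
  induction μ using WellFoundedLT.induction generalizing R L Z with
  | ind μ ih =>
    rcases isRegular_or_isSingular hμ with hμ | hμ
    · exact exists_safeMatching_of_isRegular hN hμ ih h hZ
    · exact exists_safeMatching_of_isSingular hN hμ ih h hZ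

/-- If no wave leaves an element unmatched, then `R` can be matched into `L`. -/
theorem exists_matching (hN : ∀ e, e ∈ N e) (h : ¬ Hindered N R L) :
    ∃ g : E → E, InjOn g R ∧ MapsTo g R L ∧ ∀ x ∈ R, g x ∈ N x := by
  obtain ⟨X, Y, g, hg, hX, -⟩ := exists_safeMatching hN (max ℵ₀ #E) (le_max_left _ _) R L univ h
    (by simp)
  have hRX : R ⊆ X := fun x hx => hX ⟨hx, trivial⟩
  exact ⟨g, hg.inj.mono hRX, fun x hx => hg.subL (hg.maps (hRX hx)), fun x hx => hg.adj x (hRX hx)⟩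

end Wave

namespace MultiDigraph

open Function Set Relation

variable {V : Type v} {E : Type u} {D : MultiDigraph V E} {L L' : Set E} {r s t w : V} {e : E}
  {p : List E}

/-- There is an edge from `u` to `w`. -/
def Step (D : MultiDigraph V E) (u w : V) : Prop := ∃ e, D.tail e = u ∧ D.head e = w

/-- There is a nontrivial walk from `u` to `w`. -/
def Lt (D : MultiDigraph V E) (u w : V) : Prop := TransGen D.Step u w

/-- There is a walk from `u` to `w`. -/
def Le (D : MultiDigraph V E) (u w : V) : Prop := ReflTransGen D.Step u w

theorem step_edge (D : MultiDigraph V E) (e : E) : D.Step (D.tail e) (D.head e) := ⟨e, rfl, rfl⟩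

theorem lt_edge (D : MultiDigraph V E) (e : E) : D.Lt (D.tail e) (D.head e) :=
  .single (D.step_edge e)

theorem le_iff {u w : V} : D.Le u w ↔ u = w ∨ D.Lt u w := by
  rw [Le, reflTransGen_iff_eq_or_transGen, eq_comm, Lt]

theorem Lt.le {u w : V} (h : D.Lt u w) : D.Le u w := TransGen.to_reflTransGen h

theorem wellFounded_step (hc : ¬ D.HasCycle) (hb : ¬ D.HasBackwardInfinitePath) :
    WellFounded D.Step := by
  classical
  rw [wellFounded_iff_isEmpty_descending_chain]
  refine ⟨fun ⟨x, hx⟩ => ?_⟩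
  choose e he he' using hx
  by_cases hinj : Injective x
  · refine hb ⟨e, fun n => by rw [he, he'], ?_⟩
    simpa only [he'] using hinj
  · have hex : ∃ b a, a < b ∧ x a = x b := by
      simp only [Injective, not_forall] at hinj
      obtain ⟨a, b, hab, hne⟩ := hinj
      rcases lt_or_gt_of_ne hne with h | h
      · exact ⟨b, a, h, hab⟩
      · exact ⟨a, b, h, hab.symm⟩
    obtain ⟨a, hab, hx⟩ := Nat.find_spec hex
    have hmin := fun m hm => Nat.find_min hex (m := m) hm
    set b := Nat.find hex
    have hne : List.ofFn (fun i : Fin (b - a) => e (b - 1 - i)) ≠ [] := by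
      rw [Ne, List.ofFn_eq_nil_iff]
      omega
    refine hc ⟨List.ofFn (fun i : Fin (b - a) => e (b - 1 - i)), hne, ?_, ?_, ?_⟩
    · refine List.isChain_ofFn.2 ?_
      intro i hi
      rw [he', he]
      congr 1
      simp only
      omega
    · rw [List.getLast_ofFn, List.head_ofFn, he', he]
      have h1 : b - 1 - (b - a - 1) = a := by omega
      have h2 : b - 1 - 0 + 1 = b := by omega
      simp only [h1, h2, hx]
    · rw [List.map_ofFn, List.nodup_ofFn]
      intro i j hij
      simp only [comp_apply, he'] at hij
      have hi := i.2
      have hj := j.2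
      rcases lt_trichotomy (b - 1 - i.1) (b - 1 - j.1) with h | h | h
      · exact absurd ⟨_, h, hij⟩ (hmin _ (by omega))
      · exact Fin.ext (by omega)
      · exact absurd ⟨_, h, hij.symm⟩ (hmin _ (by omega))

theorem wellFounded_lt (h : WellFounded D.Step) : WellFounded D.Lt := h.transGen

theorem lt_irrefl (h : WellFounded D.Step) (u : V) : ¬ D.Lt u u :=
  (wellFounded_lt h).irrefl.irrefl u

theorem Lt.ne (h : WellFounded D.Step) {u w : V} (huw : D.Lt u w) : u ≠ w := by
  rintro rfl
  exact lt_irrefl h u huw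

theorem pairwise_of_isChain (hp : p.IsChain fun e f => D.head e = D.tail f) :
    p.Pairwise fun e f => D.Le (D.head e) (D.tail f) := by
  have : Trans (fun e f => D.Le (D.head e) (D.tail f)) (fun e f => D.Le (D.head e) (D.tail f))
      (fun e f => D.Le (D.head e) (D.tail f)) :=
    ⟨fun {_ b _} hab hbc => ReflTransGen.trans (hab.tail (D.step_edge b)) hbc⟩
  exact (hp.imp fun e f (hef : D.head e = D.tail f) =>
    show D.Le (D.head e) (D.tail f) from hef ▸ ReflTransGen.refl).pairwise

theorem nodup_of_isChain (h : WellFounded D.Step) (hne : p ≠ [])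
    (hp : p.IsChain fun e f => D.head e = D.tail f) :
    (D.tail (p.head hne) :: p.map D.head).Nodup := by
  have hpw := pairwise_of_isChain hp
  rw [List.nodup_cons]
  constructor
  · intro hmem
    obtain ⟨f, hf, hfe⟩ := List.mem_map.1 hmem
    cases p with
    | nil => exact hne rfl
    | cons e q =>
      simp only [List.head_cons] at hfe
      rcases List.mem_cons.1 hf with rfl | hf
      · exact (D.lt_edge _).ne h hfe.symm
      · exact Lt.ne h (((D.lt_edge e).trans_left (List.rel_of_pairwise_cons hpw hf)).trans
          (D.lt_edge f)) hfe.symm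
  · rw [List.Nodup, List.pairwise_map]
    exact hpw.imp fun {e f} hef => Lt.ne h (TransGen.trans_right hef (D.lt_edge f))

theorem isPathIn_of_isChain (h : WellFounded D.Step) (hne : p ≠ [])
    (hp : p.IsChain fun e f => D.head e = D.tail f) (hL : ∀ e ∈ p, e ∈ L) :
    D.IsPathIn L (D.tail (p.head hne)) (D.head (p.getLast hne)) p :=
  ⟨hne, rfl, rfl, hp, nodup_of_isChain h hne hp, hL⟩

theorem isPathIn_singleton (h : WellFounded D.Step) (he : e ∈ L) :
    D.IsPathIn L (D.tail e) (D.head e) [e] :=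
  isPathIn_of_isChain h (List.cons_ne_nil _ _) (List.isChain_singleton e) (by simpa using he)

theorem IsPathIn.concat (h : WellFounded D.Step) (hp : D.IsPathIn L s (D.tail e) p) (he : e ∈ L) :
    D.IsPathIn L s (D.head e) (p ++ [e]) := by
  obtain ⟨hne, rfl, ht, hch, -, hL⟩ := hp
  have hne' : p ++ [e] ≠ [] := by simp
  have := isPathIn_of_isChain (L := L) h hne' (List.isChain_append.2 ⟨hch,
    List.isChain_singleton e, fun x hx y hy => by
      rw [List.getLast?_eq_some_getLast hne, Option.mem_some_iff] at hx
      simp only [List.head?_cons, Option.mem_some_iff] at hy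
      rw [← hx, ← hy, ht]⟩) (fun x hx => by
      rcases List.mem_append.1 hx with hx | hx
      · exact hL x hx
      · rwa [List.mem_singleton.1 hx])
  rwa [List.head_append_of_ne_nil hne, List.getLast_append_singleton] at this

theorem IsPathIn.head_le (hp : D.IsPathIn L s t p) (he : e ∈ p) : D.Le (D.head e) t := by
  obtain ⟨hne, -, rfl, hch, -, -⟩ := hp
  have hpw := pairwise_of_isChain hch
  rw [← List.dropLast_append_getLast hne] at hpw he
  rcases List.mem_append.1 he with he | he
  · exact ((List.pairwise_append.1 hpw).2.2 e he _ (List.mem_singleton_self _)).tail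
      (D.step_edge _)
  · rw [List.mem_singleton.1 he]
    exact ReflTransGen.refl

theorem IsPathIn.eq_of_tail_eq (h : WellFounded D.Step) (hp : D.IsPathIn L s t p) {f : E}
    (he : e ∈ p) (hf : f ∈ p) (hef : D.tail e = D.tail f) : e = f := by
  obtain ⟨-, -, -, hch, -, -⟩ := hp
  have hpw : p.Pairwise fun e f => D.tail e ≠ D.tail f :=
    (pairwise_of_isChain hch).imp fun {e f} hef => Lt.ne h (TransGen.trans_left (D.lt_edge e) hef)
  by_contra hne
  have : Std.Symm fun e f => D.tail e ≠ D.tail f := ⟨fun _ _ => Ne.symm⟩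
  exact hpw.forall he hf hne hef

theorem IsPathIn.exists_pred (hp : D.IsPathIn L s t p) (he : e ∈ p) (hes : D.tail e ≠ s) :
    ∃ f ∈ p, D.head f = D.tail e := by
  obtain ⟨hne, rfl, -, hch, -, -⟩ := hp
  obtain ⟨i, hi, rfl⟩ := List.getElem_of_mem he
  cases i with
  | zero => exact absurd (by rw [List.head_eq_getElem]) hes
  | succ i => exact ⟨p[i], List.getElem_mem _, List.isChain_iff_getElem.1 hch i hi⟩

theorem IsPathIn.exists_mem_edgesInto (hp : D.IsPathIn L s t p) {X : Set V} (hs : s ∉ X)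
    (ht : t ∈ X) : ∃ e ∈ p, e ∈ D.edgesInto univ X := by
  obtain ⟨hne, rfl, rfl, hch, -, -⟩ := hp
  induction p with
  | nil => exact absurd rfl hne
  | cons e q ih =>
    by_cases heX : D.head e ∈ X
    · exact ⟨e, List.mem_cons_self, trivial, hs, heX⟩
    · cases q with
      | nil => exact absurd ht heX
      | cons f q =>
        replace hch := List.isChain_cons_cons.1 hch
        obtain ⟨g, hg, hgX⟩ := ih (List.cons_ne_nil _ _)
          (by rw [List.head_cons, ← hch.1]; exact heX) (by simpa using ht) hch.2
        exact ⟨g, List.mem_cons_of_mem _ hg, hgX⟩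

end MultiDigraph

namespace MultiDigraph

open Function Set Relation

variable {V : Type v} {E : Type u} {D : MultiDigraph V E} {G G' : Set E} {r v y : V}
  {X Y : Set V} {f : E → E}

/-- The edges of `G` whose head lies in `X` but differs from `v`. -/
def inner (D : MultiDigraph V E) (G : Set E) (v : V) (X : Set V) : Set E :=
  {e | e ∈ G ∧ D.head e ∈ X ∧ D.head e ≠ v}

/-- `f` moves the edges of `G` with head in `X \ {v}` injectively along edges of `G` inside `X`,
every edge either being fixed or being moved to an edge starting at its head. -/
structure IsLinking (D : MultiDigraph V E) (G : Set E) (v : V) (X : Set V) (f : E → E) :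
    Prop where
  mem : ∀ e ∈ D.inner G v X, f e ∈ G
  head_mem : ∀ e ∈ D.inner G v X, D.head (f e) ∈ X
  tail_mem : ∀ e ∈ D.inner G v X, D.tail (f e) ∈ X
  adj : ∀ e ∈ D.inner G v X, f e = e ∨ D.tail (f e) = D.head e
  inj : InjOn f (D.inner G v X)
  rayless : Wave.Rayless (D.inner G v X) f

/-- The edges of `G` entering `X` can be prolonged inside `X` to disjoint walks ending in `v`. -/
def Linked (D : MultiDigraph V E) (G : Set E) (v : V) (X : Set V) : Prop :=
  ∃ f, D.IsLinking G v X f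

theorem linked_singleton (D : MultiDigraph V E) (G : Set E) (v : V) : D.Linked G v {v} := by
  have h : ∀ e, e ∉ D.inner G v {v} := fun e he => he.2.2 he.2.1
  exact ⟨id, fun e he => absurd he (h e), fun e he => absurd he (h e),
    fun e he => absurd he (h e), fun e he => absurd he (h e), fun e he => absurd he (h e),
    fun x _ hx => absurd (hx 0) (h _)⟩

theorem Linked.of_subset (h : D.Linked G' v X) (hG : G' ⊆ G)
    (hX : ∀ e ∈ G, D.head e ∈ X → D.head e ≠ v → e ∈ G') : D.Linked G v X := by
  obtain ⟨f, hf⟩ := h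
  have hi : D.inner G v X = D.inner G' v X :=
    Subset.antisymm (fun e he => ⟨hX e he.1 he.2.1 he.2.2, he.2⟩) fun e he => ⟨hG he.1, he.2⟩
  refine ⟨f, ?_, ?_, ?_, ?_, ?_, ?_⟩ <;> rw [hi]
  exacts [fun e he => hG (hf.mem e he), hf.head_mem, hf.tail_mem, hf.adj, hf.inj, hf.rayless]

theorem linked_iUnion {ι : Type w} {Z : ι → Set V} (h : ∀ i, D.Linked G v (Z i)) :
    D.Linked G v (⋃ i, Z i) := by
  obtain ⟨_, _⟩ := exists_wellFoundedLT ι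
  rcases isEmpty_or_nonempty ι with _ | _
  · obtain ⟨f, hf⟩ := D.linked_singleton G v
    have hi : ∀ e, e ∉ D.inner G v (⋃ i, Z i) := fun e he => by simpa using he.2.1
    exact ⟨f, fun e he => absurd he (hi e), fun e he => absurd he (hi e),
      fun e he => absurd he (hi e), fun e he => absurd he (hi e), fun e he => absurd he (hi e),
      fun x _ hx => absurd (hx 0) (hi _)⟩
  choose f hf using h
  have hidx : ∀ y ∈ ⋃ i, Z i, ∃ i, y ∈ Z i ∧ ∀ j, y ∈ Z j → i ≤ j := by
    intro y hy
    have hne : {i | y ∈ Z i}.Nonempty := mem_iUnion.1 hy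
    have hwf : WellFounded ((· < ·) : ι → ι → Prop) := _root_.wellFounded_lt
    exact ⟨hwf.min _ hne, hwf.min_mem _ hne, fun j hj => hwf.min_le hj⟩
  choose! I hI hmin using hidx
  have hin : ∀ e ∈ D.inner G v (⋃ i, Z i), e ∈ D.inner G v (Z (I (D.head e))) :=
    fun e he => ⟨he.1, hI _ he.2.1, he.2.2⟩
  have hU : ∀ {y i}, y ∈ Z i → y ∈ ⋃ i, Z i := fun h => mem_iUnion.2 ⟨_, h⟩
  have heq : ∀ e ∈ D.inner G v (⋃ i, Z i), ∀ e' ∈ D.inner G v (⋃ i, Z i),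
      f (I (D.head e)) e = f (I (D.head e')) e' → f (I (D.head e)) e = e →
      I (D.head e) = I (D.head e') := by
    intro e he e' he' hee' hid
    rcases (hf (I (D.head e'))).adj e' (hin e' he') with h | h
    · rw [← hid, hee', h]
    · rw [← hee', hid] at h
      refine le_antisymm (hmin _ he.2.1 _ ?_) (hmin _ he'.2.1 _ ?_)
      · have := (hf (I (D.head e'))).head_mem e' (hin e' he')
        rwa [← hee', hid] at this
      · have := (hf (I (D.head e))).tail_mem e (hin e he)
        rwa [hid, h] at this
  refine ⟨fun e => f (I (D.head e)) e, fun e he => (hf _).mem e (hin e he),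
    fun e he => hU ((hf _).head_mem e (hin e he)), fun e he => hU ((hf _).tail_mem e (hin e he)),
    fun e he => (hf _).adj e (hin e he), fun e he e' he' hee' => ?_, fun x hx hxm hxf => ?_⟩
  · beta_reduce at hee'
    have hII : I (D.head e) = I (D.head e') := by
      rcases (hf _).adj e (hin e he) with h | h
      · exact heq e he e' he' hee' h
      · rcases (hf _).adj e' (hin e' he') with h' | h'
        · exact (heq e' he' e he hee'.symm h').symm
        · rw [← h, ← h', hee']
    refine (hf _).inj (hin e he) (hII ▸ hin e' he') ?_
    rw [hee', hII]
  · have hanti : Antitone fun n => I (D.head (x n)) := antitone_nat_of_succ_le fun n => by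
      refine hmin _ (hxm _).2.1 _ ?_
      rw [hxf n]
      exact (hf _).head_mem _ (hin _ (hxm n))
    obtain ⟨m, hm⟩ := WellFoundedLT.antitone_chain_condition hanti
    refine (hf (I (D.head (x m)))).rayless.false_of_eventually hx m (fun n hn => ?_)
      fun n hn => ?_
    · have := hin _ (hxm n)
      rwa [← hm n hn] at this
    · have := hxf n
      rwa [← hm n hn] at this

theorem Linked.union (hX : D.Linked G v X) (hy : y ∈ X) (hY : D.Linked G y Y) :
    D.Linked G v (X ∪ Y) := by
  classical
  obtain ⟨f, hf⟩ := hX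
  obtain ⟨g, hg⟩ := hY
  have hin : ∀ e ∈ D.inner G v (X ∪ Y), D.head e ∈ X → e ∈ D.inner G v X :=
    fun e he heX => ⟨he.1, heX, he.2.2⟩
  have hin' : ∀ e ∈ D.inner G v (X ∪ Y), D.head e ∉ X → e ∈ D.inner G y Y :=
    fun e he heX => ⟨he.1, he.2.1.resolve_left heX, fun h => heX (h ▸ hy)⟩
  have hne : ∀ e ∈ D.inner G v (X ∪ Y), ∀ e' ∈ D.inner G v (X ∪ Y), D.head e ∈ X →
      D.head e' ∉ X → f e ≠ g e' := by
    intro e he e' he' heX he'X hee'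
    rcases hg.adj e' (hin' e' he' he'X) with h | h
    · rw [← hee'] at h
      exact he'X (h ▸ hf.head_mem e (hin e he heX))
    · rw [← hee'] at h
      exact he'X (h ▸ hf.tail_mem e (hin e he heX))
  refine ⟨fun e => if D.head e ∈ X then f e else g e, fun e he => ?_, fun e he => ?_,
    fun e he => ?_, fun e he => ?_, fun e he e' he' hee' => ?_, fun x hx hxm hxf => ?_⟩
  · split_ifs with h
    exacts [hf.mem e (hin e he h), hg.mem e (hin' e he h)]
  · split_ifs with h
    exacts [Or.inl (hf.head_mem e (hin e he h)), Or.inr (hg.head_mem e (hin' e he h))]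
  · split_ifs with h
    exacts [Or.inl (hf.tail_mem e (hin e he h)), Or.inr (hg.tail_mem e (hin' e he h))]
  · split_ifs with h
    exacts [hf.adj e (hin e he h), hg.adj e (hin' e he h)]
  · beta_reduce at hee'
    split_ifs at hee' with h h' h'
    exacts [hf.inj (hin e he h) (hin e' he' h') hee', absurd hee' (hne e he e' he' h h'),
      absurd hee'.symm (hne e' he' e he h' h), hg.inj (hin' e he h) (hin' e' he' h') hee']
  · by_cases hex : ∃ m, D.head (x m) ∈ X
    · obtain ⟨m, hm⟩ := hex
      have hstay : ∀ n, m ≤ n → D.head (x n) ∈ X := fun n hn => by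
        induction n, hn using Nat.le_induction with
        | base => exact hm
        | succ n _ ih =>
          rw [hxf n, if_pos ih]
          exact hf.head_mem _ (hin _ (hxm n) ih)
      exact hf.rayless.false_of_eventually hx m (fun n hn => hin _ (hxm n) (hstay n hn))
        fun n hn => by rw [hxf n, if_pos (hstay n hn)]
    · push Not at hex
      exact hg.rayless x hx (fun n => hin' _ (hxm n) (hex n)) fun n => by
        rw [hxf n, if_neg (hex n)]

/-- A wave outside a linked set can be used to enlarge the linked set. -/
theorem Linked.union_of_isWave {P : Set E} {h : E → E} (hX : D.Linked G v X)
    (hw : Wave.IsWave (fun e => {b | b = e ∨ D.head b = D.tail e})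
      {e | e ∈ G ∧ D.tail e ∉ X ∧ D.tail e ≠ r} {e | e ∈ G ∧ D.tail e ∉ X ∧ D.head e ∉ X} P h) :
    D.Linked G v (X ∪ D.tail '' P) := by
  classical
  obtain ⟨f, hf⟩ := hX
  set N : E → Set E := fun e => {b | b = e ∨ D.head b = D.tail e}
  set C : Set E := {e | e ∈ G ∧ D.tail e ∉ X ∧ D.head e ∉ X}
  have hin : ∀ e ∈ D.inner G v (X ∪ D.tail '' P), D.head e ∈ X → e ∈ D.inner G v X :=
    fun e he heX => ⟨he.1, heX, he.2.2⟩
  have hin' : ∀ e ∈ D.inner G v (X ∪ D.tail '' P), D.head e ∉ X → D.tail e ∉ X →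
      e ∈ C ∩ Wave.nbhd N P := by
    intro e he heX htX
    obtain ⟨p, hp, hpe⟩ := he.2.1.resolve_left heX
    exact ⟨⟨he.1, htX, heX⟩, p, hp, Or.inr hpe.symm⟩
  have hhead : ∀ e ∈ D.inner G v (X ∪ D.tail '' P), D.head e ∉ X → D.tail e ∉ X →
      D.head (h e) ∈ X ∪ D.tail '' P := by
    intro e he heX htX
    obtain ⟨heC, heN⟩ := hin' e he heX htX
    have hP := hw.maps e heC heN
    by_contra hcon
    have hhe : h e ∈ C := ⟨(hw.sub hP).1, (hw.sub hP).2.1, fun hh => hcon (Or.inl hh)⟩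
    have hhN : h e ∈ Wave.nbhd N P := ⟨_, hP, Or.inl rfl⟩
    rcases hw.adj _ hhe hhN with h' | h'
    · have := hw.inj ⟨hhe, hhN⟩ ⟨heC, heN⟩ h'.symm
      exact hcon (by rw [this]; exact he.2.1)
    · exact hcon (Or.inr ⟨_, hw.maps _ hhe hhN, h'.symm⟩)
  refine ⟨fun e => if D.head e ∈ X then f e else if D.tail e ∈ X then e else h e,
    fun e he => ?_, fun e he => ?_,
    fun e he => ?_, fun e he => ?_, fun e he e' he' hee' => ?_, fun x hx hxm hxf => ?_⟩
  · split_ifs with h1 h2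
    exacts [hf.mem e (hin e he h1), he.1, (hw.sub (hw.maps e (hin' e he h1 h2).1
      (hin' e he h1 h2).2)).1]
  · split_ifs with h1 h2
    exacts [Or.inl (hf.head_mem e (hin e he h1)), he.2.1, hhead e he h1 h2]
  · split_ifs with h1 h2
    exacts [Or.inl (hf.tail_mem e (hin e he h1)), Or.inl h2,
      Or.inr ⟨_, hw.maps e (hin' e he h1 h2).1 (hin' e he h1 h2).2, rfl⟩]
  · split_ifs with h1 h2
    exacts [hf.adj e (hin e he h1), Or.inl rfl,
      (hw.adj e (hin' e he h1 h2).1 (hin' e he h1 h2).2).imp Eq.symm Eq.symm]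
  · have hA : ∀ e ∈ D.inner G v (X ∪ D.tail '' P), D.head e ∈ X →
        D.head (f e) ∈ X ∧ D.tail (f e) ∈ X :=
      fun e he h => ⟨hf.head_mem e (hin e he h), hf.tail_mem e (hin e he h)⟩
    have hB : ∀ e ∈ D.inner G v (X ∪ D.tail '' P), D.head e ∉ X → D.tail e ∉ X →
        D.tail (h e) ∉ X :=
      fun e he h1 h2 => (hw.sub (hw.maps e (hin' e he h1 h2).1 (hin' e he h1 h2).2)).2.1
    beta_reduce at hee'
    split_ifs at hee' with h1 h1' h2' h2 h3 h3' h4 h5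
    · exact hf.inj (hin e he h1) (hin e' he' h1') hee'
    · exact absurd (hee' ▸ (hA e he h1).1) h1'
    · exact absurd (hee' ▸ (hA e he h1).2) (hB e' he' h1' h2')
    · exact absurd (hee' ▸ (hA e' he' h3).1) (by assumption)
    · exact hee'
    · exact absurd (hee' ▸ h2) (hB e' he' h3 h3')
    · exact absurd (hee'.symm ▸ (hA e' he' h4).2) (hB e he h1 h2)
    · exact absurd (hee'.symm ▸ h5) (hB e he h1 h2)
    · exact hw.inj (hin' e he h1 h2) (hin' e' he' h4 h5) hee'
  · by_cases hex : ∃ m, D.head (x m) ∈ X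
    · obtain ⟨m, hm⟩ := hex
      have hstay : ∀ n, m ≤ n → D.head (x n) ∈ X := fun n hn => by
        induction n, hn using Nat.le_induction with
        | base => exact hm
        | succ n _ ih =>
          rw [hxf n, if_pos ih]
          exact hf.head_mem _ (hin _ (hxm n) ih)
      exact hf.rayless.false_of_eventually hx m (fun n hn => hin _ (hxm n) (hstay n hn))
        fun n hn => by rw [hxf n, if_pos (hstay n hn)]
    · push Not at hex
      have htl : ∀ n, D.tail (x n) ∉ X := fun n hn => by
        have := hxf n
        rw [if_neg (hex n), if_pos hn] at this
        exact absurd (hx this) (by omega)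
      exact hw.rayless x hx (fun n => hin' _ (hxm n) (hex n) (htl n)) fun n => by
        rw [hxf n, if_neg (hex n), if_neg (htl n)]

end MultiDigraph

namespace MultiDigraph

open Function Set Relation

variable {V : Type v} {E : Type u} {D : MultiDigraph V E} {G M : Set E} {r v : V}
  {X : Set V} {f π ψ : E → E}

theorem injective_of_walk (h : WellFounded D.Step) {x : ℕ → E}
    (hx : ∀ n, D.tail (x (n + 1)) = D.head (x n)) : Injective x := by
  have hlt : ∀ m n, m < n → D.Lt (D.head (x m)) (D.head (x n)) := fun m n hmn => by
    induction n, hmn using Nat.le_induction with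
    | base => exact hx m ▸ D.lt_edge _
    | succ n _ ih => exact TransGen.trans ih (hx n ▸ D.lt_edge _)
  intro m n hmn
  rcases lt_trichotomy m n with h' | h' | h'
  · exact absurd (by rw [hmn]) ((hlt m n h').ne h)
  · exact h'
  · exact absurd (by rw [hmn]) ((hlt n m h').ne h)

/-- `ψ` maps every edge of `M` that does not start in `r` to an edge of `M` preceding it. -/
def IsPred (D : MultiDigraph V E) (r : V) (M : Set E) (ψ : E → E) : Prop :=
  ∀ e ∈ M, D.tail e ≠ r → ψ e ∈ M ∧ D.head (ψ e) = D.tail e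

/-- `x` is the predecessor of `e` with respect to `ψ`. -/
def PredRel (D : MultiDigraph V E) (r : V) (M : Set E) (ψ : E → E) (x e : E) : Prop :=
  e ∈ M ∧ D.tail e ≠ r ∧ ψ e = x

theorem IsPred.exists_path (hψ : D.IsPred r M ψ) (h : WellFounded D.Step) :
    ∃ path : E → List E, ∀ e ∈ M, D.IsPathIn M r (D.head e) (path e) ∧
      ∀ x, x ∈ path e ↔ ReflTransGen (D.PredRel r M ψ) x e := by
  suffices H : ∀ u, ∀ e ∈ M, D.tail e = u → ∃ p, D.IsPathIn M r (D.head e) p ∧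
      ∀ x, x ∈ p ↔ ReflTransGen (D.PredRel r M ψ) x e by
    choose! path hpath using fun e he => H _ e he rfl
    exact ⟨path, hpath⟩
  intro u
  induction u using (wellFounded_lt h).induction with | _ u ih
  rintro e he rfl
  by_cases her : D.tail e = r
  · refine ⟨[e], her ▸ isPathIn_singleton h he, fun x => ?_⟩
    rw [List.mem_singleton, ReflTransGen.cases_tail_iff]
    refine ⟨fun hx => Or.inl hx.symm, ?_⟩
    rintro (hx | ⟨y, -, hy⟩)
    · exact hx.symm
    · exact absurd her hy.2.1
  · obtain ⟨hM, hh⟩ := hψ e he her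
    obtain ⟨p, hp, hmem⟩ := ih (D.tail (ψ e)) (hh ▸ D.lt_edge _) (ψ e) hM rfl
    refine ⟨p ++ [e], (hh ▸ hp).concat h he, fun x => ?_⟩
    rw [List.mem_append, List.mem_singleton, hmem, ReflTransGen.cases_tail_iff _ x e]
    constructor
    · rintro (hx | hx)
      · exact Or.inr ⟨_, hx, he, her, rfl⟩
      · exact Or.inl hx.symm
    · rintro (hx | ⟨y, hx, -, -, rfl⟩)
      · exact Or.inr hx.symm
      · exact Or.inl hx

theorem IsPred.eq_or_lt (hψ : D.IsPred r M ψ) {x e : E}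
    (hx : ReflTransGen (D.PredRel r M ψ) x e) : x = e ∨ D.Lt (D.head x) (D.head e) := by
  induction hx with
  | refl => exact Or.inl rfl
  | @tail y z _ hyz ih =>
    have hlt : D.Lt (D.head y) (D.head z) := by
      obtain ⟨hz, hzr, rfl⟩ := hyz
      rw [(hψ z hz hzr).2]
      exact D.lt_edge z
    rcases ih with rfl | ih
    · exact Or.inr hlt
    · exact Or.inr (TransGen.trans ih hlt)

theorem IsPred.eq_of_head_eq (hψ : D.IsPred r M ψ) (h : WellFounded D.Step)
    (hinj : InjOn ψ (M ∩ {e | D.tail e ≠ r})) {x e e' : E} (hee' : D.head e = D.head e')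
    (hx : ReflTransGen (D.PredRel r M ψ) x e) (hx' : ReflTransGen (D.PredRel r M ψ) x e') :
    e = e' := by
  have hU : Relator.RightUnique (D.PredRel r M ψ) := by
    rintro x a b ⟨ha, har, rfl⟩ ⟨hb, hbr, hab⟩
    exact hinj ⟨ha, har⟩ ⟨hb, hbr⟩ hab.symm
  rcases hx.total_of_right_unique hU hx' with h1 | h1
  · exact (hψ.eq_or_lt h1).resolve_right fun hlt => hlt.ne h hee'
  · exact ((hψ.eq_or_lt h1).resolve_right fun hlt => hlt.ne h hee'.symm).symm

/-- A predecessor map which does not enter `X` from outside produces paths crossing into `X`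
exactly once. -/
theorem IsPred.exists_paths (hψ : D.IsPred r M ψ) (h : WellFounded D.Step)
    (hinj : InjOn ψ (M ∩ {e | D.tail e ≠ r})) (hrX : r ∉ X) (hvX : v ∈ X)
    (hout : ∀ e ∈ M, D.tail e ≠ r → D.tail e ∉ X → D.tail (ψ e) ∉ X)
    (hterm : ∀ c ∈ D.edgesInto univ X, ∃ e ∈ M, D.head e = v ∧
      ReflTransGen (D.PredRel r M ψ) c e) :
    ∃ Ps : Set (List E), (∀ p ∈ Ps, D.IsPathIn M r v p) ∧
      Ps.Pairwise (fun p q => p.Disjoint q) ∧ (∀ e ∈ M, D.head e = v → ∃ p ∈ Ps, e ∈ p) ∧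
      IsTransversal Ps (D.edgesInto univ X) := by
  obtain ⟨path, hpath⟩ := hψ.exists_path h
  refine ⟨path '' {e | e ∈ M ∧ D.head e = v}, ?_, ?_, ?_, ?_, ?_⟩
  · rintro _ ⟨e, ⟨he, rfl⟩, rfl⟩
    exact (hpath e he).1
  · rintro _ ⟨e, ⟨he, hev⟩, rfl⟩ _ ⟨e', ⟨he', he'v⟩, rfl⟩ hne x hx hx'
    refine hne ?_
    rw [hψ.eq_of_head_eq h hinj (hev.trans he'v.symm) (((hpath e he).2 x).1 hx)
      (((hpath e' he').2 x).1 hx')]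
  · exact fun e he hev => ⟨_, ⟨e, ⟨he, hev⟩, rfl⟩, ((hpath e he).2 e).2 .refl⟩
  · rintro _ ⟨e, ⟨he, rfl⟩, rfl⟩
    obtain ⟨x, hxp, hxX⟩ := (hpath e he).1.exists_mem_edgesInto hrX hvX
    refine ⟨x, ⟨hxX, hxp⟩, ?_⟩
    have key : ∀ {a b}, ReflTransGen (D.PredRel r M ψ) a b → D.tail b ∉ X →
        D.head a ∈ X → a = b := by
      intro a b hab hb ha
      have H : D.tail a ∉ X ∧ (a = b ∨ D.head a ∉ X) := by
        clear ha
        induction hab using ReflTransGen.head_induction_on with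
        | refl => exact ⟨hb, Or.inl rfl⟩
        | head hac _ ih =>
          obtain ⟨hc, hcr, rfl⟩ := hac
          refine ⟨hout _ hc hcr ih.1, Or.inr ?_⟩
          rw [(hψ _ hc hcr).2]
          exact ih.1
      exact H.2.resolve_right (not_not_intro ha)
    rintro y ⟨hyX, hyp⟩
    have hU : Relator.RightUnique (swap (D.PredRel r M ψ)) := by
      rintro x a b ⟨_, _, rfl⟩ ⟨_, _, rfl⟩
      rfl
    have h1 := reflTransGen_swap.2 (((hpath e he).2 x).1 hxp)
    have h2 := reflTransGen_swap.2 (((hpath e he).2 y).1 hyp)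
    rcases h1.total_of_right_unique hU h2 with h3 | h3
    · exact key (reflTransGen_swap.1 h3) hxX.2.1 hyX.2.2
    · exact (key (reflTransGen_swap.1 h3) hyX.2.1 hxX.2.2).symm
  · intro c hc
    obtain ⟨e, he, hev, hce⟩ := hterm c hc
    exact ⟨_, ⟨e, ⟨he, hev⟩, rfl⟩, ((hpath e he).2 c).2 hce⟩

/-- A family of disjoint paths starting in `r` has an injective predecessor map. -/
theorem exists_pred_of_paths (h : WellFounded D.Step) {L : Set E} {Ps : Set (List E)}
    (hPs : ∀ p ∈ Ps, D.IsPathIn L r v p) (hdisj : Ps.Pairwise fun p q => p.Disjoint q) :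
    ∃ π, D.IsPred r {e | ∃ p ∈ Ps, e ∈ p} π ∧
      InjOn π ({e | ∃ p ∈ Ps, e ∈ p} ∩ {e | D.tail e ≠ r}) := by
  have H : ∀ e, ∃ x, (∃ p ∈ Ps, e ∈ p) → D.tail e ≠ r →
      (∃ p ∈ Ps, e ∈ p ∧ x ∈ p) ∧ D.head x = D.tail e := by
    intro e
    by_cases he : (∃ p ∈ Ps, e ∈ p) ∧ D.tail e ≠ r
    · obtain ⟨⟨p, hp, hep⟩, her⟩ := he
      obtain ⟨x, hx, hxe⟩ := (hPs p hp).exists_pred hep her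
      exact ⟨x, fun _ _ => ⟨⟨p, hp, hep, hx⟩, hxe⟩⟩
    · exact ⟨e, fun h1 h2 => absurd ⟨h1, h2⟩ he⟩
  choose π hπ using H
  refine ⟨π, fun e he her => ?_, ?_⟩
  · obtain ⟨⟨p, hp, -, hx⟩, hxe⟩ := hπ e he her
    exact ⟨⟨p, hp, hx⟩, hxe⟩
  · rintro e ⟨he, her⟩ e' ⟨he', her'⟩ hee'
    obtain ⟨⟨p, hp, hep, hx⟩, hxe⟩ := hπ e he her
    obtain ⟨⟨q, hq, heq, hx'⟩, hxe'⟩ := hπ e' he' her'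
    rw [← hee'] at hx' hxe'
    have hpq : p = q := by
      by_contra hne
      exact hdisj hp hq hne hx hx'
    subst hpq
    exact (hPs p hp).eq_of_tail_eq h hep heq (hxe.symm.trans hxe')

end MultiDigraph

namespace MultiDigraph

open Function Set Relation

variable {V : Type v} {E : Type u} {D : MultiDigraph V E} {G A B : Set E} {v : V} {X : Set V}
  {f π : E → E}

/-- The edges reached from `A` by following the predecessor map `π` inside `X`. -/
inductive Back (D : MultiDigraph V E) (X : Set V) (A : Set E) (π : E → E) : E → Prop
  | base {e : E} (he : e ∈ A) : Back D X A π e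
  | step {z : E} (hz : Back D X A π z) (hX : D.tail z ∈ X) : Back D X A π (π z)

/-- `a` is the predecessor of `b`, where `b` is one of the edges reached from `A`. -/
def BackRel (D : MultiDigraph V E) (X : Set V) (A : Set E) (π : E → E) (a b : E) : Prop :=
  D.Back X A π b ∧ D.tail b ∈ X ∧ π b = a

/-- The edges reached from outside `X` along the linking `f`, where a path arriving on an edge of
a backward track from `A` is continued only if that track is itself reached later on. -/
inductive Reach (D : MultiDigraph V E) (v : V) (X : Set V) (A : Set E) (π f : E → E) : E → Prop
  | base {e : E} (he : e ∈ D.edgesInto univ X) : Reach D v X A π f e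
  | skip {x : E} (hx : Reach D v X A π f x) (hv : D.head x ≠ v) (hb : ¬ D.Back X A π x) :
      Reach D v X A π f (f x)
  | cont {x z : E} (hx : Reach D v X A π f x) (hv : D.head x ≠ v)
      (hxz : TransGen (D.BackRel X A π) x z) (hz : Reach D v X A π f z) : Reach D v X A π f (f x)

/-- The edges of the backward tracks from `A` after which the track is not reached any more. -/
def Tail (D : MultiDigraph V E) (v : V) (X : Set V) (A : Set E) (π f : E → E) : Set E :=
  {x | D.Back X A π x ∧ ∀ z, TransGen (D.BackRel X A π) x z → ¬ D.Reach v X A π f z}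

/-- Pym's linkage argument: the linking `f` of `X` and a system of backward tracks from `A`
combine to a system of paths in `X` starting with all edges that enter `X` and ending with a set
of edges that contains `A`. -/
theorem IsLinking.exists_combine (hf : D.IsLinking G v X f) (h : WellFounded D.Step)
    (hδ : D.edgesInto univ X ⊆ G) (hvX : v ∈ X) (hAB : A ⊆ B) (hA : ∀ e ∈ A, D.head e = v)
    (hBG : B ⊆ G) (hBv : ∀ e ∈ B, D.tail e ≠ v)
    (hπ : ∀ e ∈ B, D.tail e ∈ X → π e ∈ B ∧ D.head (π e) = D.tail e)
    (hinj : InjOn π (B ∩ {e | D.tail e ∈ X})) :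
    ∃ (M : Set E) (ψ : E → E), M ⊆ G ∧ (∀ e ∈ M, D.head e ∈ X) ∧ D.edgesInto univ X ⊆ M ∧ A ⊆ M ∧
      (∀ e ∈ M, D.tail e ∈ X → ψ e ∈ M ∧ D.head (ψ e) = D.tail e) ∧
      InjOn ψ (M ∩ {e | D.tail e ∈ X}) ∧
      ∀ x ∈ M, ∃ e ∈ M, D.head e = v ∧
        ReflTransGen (fun a b => b ∈ M ∧ D.tail b ∈ X ∧ ψ b = a) x e := by
  set Q := D.Back X A π
  set N := D.Reach v X A π f
  set T := D.Tail v X A π f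
  have hQB : ∀ e, Q e → e ∈ B := fun e he => by
    induction he with
    | base he => exact hAB he
    | step _ hX ih => exact (hπ _ ih hX).1
  have hQX : ∀ e, Q e → D.head e ∈ X := fun e he => by
    cases he with
    | base he => rwa [hA e he]
    | step hz hX => rwa [(hπ _ (hQB _ hz) hX).2]
  have hNG : ∀ e, N e → e ∈ G ∧ D.head e ∈ X := fun e he => by
    induction he with
    | base he => exact ⟨hδ he, he.2.2⟩
    | skip _ hv _ ih => exact ⟨hf.mem _ ⟨ih.1, ih.2, hv⟩, hf.head_mem _ ⟨ih.1, ih.2, hv⟩⟩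
    | cont _ hv _ _ ih _ => exact ⟨hf.mem _ ⟨ih.1, ih.2, hv⟩, hf.head_mem _ ⟨ih.1, ih.2, hv⟩⟩
  have hNi : ∀ e, N e → D.head e ≠ v → e ∈ D.inner G v X := fun e he hv =>
    ⟨(hNG e he).1, (hNG e he).2, hv⟩
  have hNf : ∀ e, N e → D.head e ≠ v → f e ≠ e := fun e he => by
    have aux : ∀ x, N x → (D.head x ≠ v → f x ≠ x) → D.head x ≠ v → D.head (f x) ≠ v →
        N (f x) → f (f x) ≠ f x := fun x hx ih hv hfv hfx heq =>
      ih hv (hf.inj (hNi _ hfx hfv) (hNi _ hx hv) heq)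
    induction he with
    | base he => exact fun hv heq => he.2.1 (heq ▸ hf.tail_mem _ ⟨hδ he, he.2.2, hv⟩)
    | skip hx hv hb ih => exact fun hfv => aux _ hx ih hv hfv (.skip hx hv hb)
    | cont hx hv hxz hz ih _ => exact fun hfv => aux _ hx ih hv hfv (.cont hx hv hxz hz)
  have hpre : ∀ z, N z → D.tail z ∈ X → ∃ x, N x ∧ x ∉ T ∧ D.head x ≠ v ∧ f x = z := by
    intro z hz hX
    cases hz with
    | base he => exact absurd hX he.2.1
    | skip hx hv hb => exact ⟨_, hx, fun hT => hb hT.1, hv, rfl⟩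
    | cont hx hv hxz hz => exact ⟨_, hx, fun hT => hT.2 _ hxz hz, hv, rfl⟩
  have hpost : ∀ x, N x → x ∉ T → D.head x ≠ v → N (f x) := by
    intro x hx hxT hv
    by_cases hQ : Q x
    · have : ∃ z, TransGen (D.BackRel X A π) x z ∧ N z := by
        by_contra! hcon
        exact hxT ⟨hQ, hcon⟩
      obtain ⟨z, hxz, hz⟩ := this
      exact .cont hx hv hxz hz
    · exact .skip hx hv hQ
  have hTπ : ∀ z ∈ T, ¬ N z → D.tail z ∈ X → π z ∈ T := by
    refine fun z hz hzN hX => ⟨.step hz.1 hX, fun y hy => ?_⟩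
    obtain ⟨c, ⟨hc, hcX, hcz⟩, hcy⟩ := TransGen.head'_iff.1 hy
    have := hinj ⟨hQB _ hc, hcX⟩ ⟨hQB _ hz.1, hX⟩ hcz
    subst this
    rcases reflTransGen_iff_eq_or_transGen.1 hcy with rfl | hcy
    exacts [hzN, hz.2 _ hcy]
  have hψ : ∀ z, ∃ x, (¬ N z → x = π z) ∧
      (N z → D.tail z ∈ X → N x ∧ x ∉ T ∧ D.head x ≠ v ∧ f x = z) := by
    intro z
    by_cases hz : N z ∧ D.tail z ∈ X
    · obtain ⟨x, hx⟩ := hpre z hz.1 hz.2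
      exact ⟨x, fun h => absurd hz.1 h, fun _ _ => hx⟩
    · exact ⟨π z, fun _ => rfl, fun h1 h2 => absurd ⟨h1, h2⟩ hz⟩
  choose ψ hψT hψN using hψ
  have hMT : ∀ {z}, z ∈ {e | N e ∨ e ∈ T} → ¬ N z → z ∈ T := fun hz hzN => hz.resolve_left hzN
  refine ⟨{e | N e ∨ e ∈ T}, ψ, ?_, ?_, fun e he => Or.inl (.base he), fun e he => ?_, ?_, ?_, ?_⟩
  · rintro e (he | he)
    exacts [(hNG e he).1, hBG (hQB e he.1)]
  · rintro e (he | he)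
    exacts [(hNG e he).2, hQX e he.1]
  · refine Or.inr ⟨.base he, fun z hz => ?_⟩
    obtain ⟨c, ⟨hc, hcX, hce⟩, -⟩ := TransGen.head'_iff.1 hz
    have h1 := (hπ c (hQB c hc) hcX).2
    rw [hce, hA e he] at h1
    exact absurd h1.symm (hBv c (hQB c hc))
  · intro z hz hX
    by_cases hzN : N z
    · obtain ⟨h1, -, h3, h4⟩ := hψN z hzN hX
      refine ⟨Or.inl h1, ?_⟩
      rcases hf.adj _ (hNi _ h1 h3) with h5 | h5
      · exact absurd h5 (hNf _ h1 h3)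
      · rw [← h5, h4]
    · rw [hψT z hzN]
      exact ⟨Or.inr (hTπ z (hMT hz hzN) hzN hX), (hπ z (hQB _ (hMT hz hzN).1) hX).2⟩
  · rintro z ⟨hz, hX⟩ z' ⟨hz', hX'⟩ hzz'
    by_cases hzN : N z <;> by_cases hzN' : N z'
    · rw [← (hψN z hzN hX).2.2.2, ← (hψN z' hzN' hX').2.2.2, hzz']
    · refine absurd (hTπ z' (hMT hz' hzN') hzN' hX') ?_
      rw [← hψT z' hzN', ← hzz']
      exact (hψN z hzN hX).2.1
    · refine absurd (hTπ z (hMT hz hzN) hzN hX) ?_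
      rw [← hψT z hzN, hzz']
      exact (hψN z' hzN' hX').2.1
    · rw [hψT z hzN, hψT z' hzN'] at hzz'
      exact hinj ⟨hQB _ (hMT hz hzN).1, hX⟩ ⟨hQB _ (hMT hz' hzN').1, hX'⟩ hzz'
  · set S : E → E → Prop := fun a b => b ∈ {e | N e ∨ e ∈ T} ∧ D.tail b ∈ X ∧ ψ b = a
    have hterm : ∀ x, Q x → x ∈ T → ∃ e ∈ {e | N e ∨ e ∈ T}, D.head e = v ∧
        ReflTransGen S x e := by
      intro x hx
      induction hx with
      | base he => exact fun hT => ⟨_, Or.inr hT, hA _ he, .refl⟩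
      | @step z hz hX ih =>
        intro hT
        have hrel : D.BackRel X A π (π z) z := ⟨hz, hX, rfl⟩
        have hzN : ¬ N z := hT.2 z (.single hrel)
        have hzT : z ∈ T := ⟨hz, fun y hy => hT.2 y (.head hrel hy)⟩
        obtain ⟨e, he, hev, hze⟩ := ih hzT
        exact ⟨e, he, hev, hze.head ⟨Or.inr hzT, hX, hψT z hzN⟩⟩
    rintro x (hx | hx)
    · by_contra hcon
      set U : Set E := {y | N y ∧ ¬ ∃ e ∈ {e | N e ∨ e ∈ T}, D.head e = v ∧ ReflTransGen S y e}
      have hUT : ∀ y ∈ U, y ∉ T := fun y hy hT => hy.2 (hterm y hT.1 hT)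
      have hUv : ∀ y ∈ U, D.head y ≠ v := fun y hy hv => hy.2 ⟨y, Or.inl hy.1, hv, .refl⟩
      have hUi : ∀ y ∈ U, y ∈ D.inner G v X := fun y hy => hNi y hy.1 (hUv y hy)
      have hUf : ∀ y ∈ U, f y ∈ U := by
        intro y hy
        have hfy := hpost y hy.1 (hUT y hy) (hUv y hy)
        have hX := hf.tail_mem y (hUi y hy)
        refine ⟨hfy, fun ⟨e, he, hev, hye⟩ => hy.2 ⟨e, he, hev, hye.head ⟨Or.inl hfy, hX, ?_⟩⟩⟩
        obtain ⟨h1, -, h3, h4⟩ := hψN _ hfy hX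
        exact hf.inj (hNi _ h1 h3) (hUi y hy) h4
      have hit : ∀ n, f^[n] x ∈ U := fun n => by
        induction n with
        | zero => exact ⟨hx, hcon⟩
        | succ n ih =>
          rw [iterate_succ_apply']
          exact hUf _ ih
      refine hf.rayless (fun n => f^[n] x) (injective_of_walk h fun n => ?_)
        (fun n => hUi _ (hit n)) fun n => iterate_succ_apply' f n x
      rw [iterate_succ_apply']
      exact (hf.adj _ (hUi _ (hit n))).resolve_left (hNf _ (hit n).1 (hUv _ (hit n)))
    · exact hterm x hx.1 hx

end MultiDigraph

namespace MultiDigraph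

open Function Set Relation

variable {V : Type v} {E : Type u} {D : MultiDigraph V E} {F G M K I L L' : Set E} {r s t v : V}
  {X : Set V} {f g ψ : E → E} {p : List E}

theorem IsPathIn.mono (hp : D.IsPathIn L s t p) (h : ∀ e ∈ p, e ∈ L → e ∈ L') :
    D.IsPathIn L' s t p := by
  obtain ⟨hne, hs, ht, hch, hnd, hL⟩ := hp
  exact ⟨hne, hs, ht, hch, hnd, fun e he => h e he (hL e he)⟩

/-- The set `I` of edges entering `v`, together with the set `K` of edges entering smaller
vertices, provides disjoint paths from `r` to `v` that cover `I` and are cut by the edges entering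
the linked set `X`. -/
structure Good (D : MultiDigraph V E) (r : V) (F K : Set E) (v : V) (I : Set E) (X : Set V) :
    Prop where
  head_eq : ∀ e ∈ I, D.head e = v
  delta_subset : D.delta F v ⊆ I
  root_notMem : r ∉ X
  mem : v ∈ X
  le : ∀ x ∈ X, D.Le x v
  edgesInto_subset : D.edgesInto univ X ⊆ K ∪ I
  linked : D.Linked (K ∪ I) v X
  exists_paths : ∃ Ps : Set (List E), (∀ p ∈ Ps, D.IsPathIn (K ∪ I) r v p) ∧
    Ps.Pairwise (fun p q => p.Disjoint q) ∧ (∀ e ∈ I, ∃ p ∈ Ps, e ∈ p) ∧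
    IsTransversal Ps (D.edgesInto univ X)

/-- The forward shift along a terminating system of paths in `X` is a linking of `X`. -/
theorem linked_of_pred (hMG : M ⊆ G) (hMX : ∀ e ∈ M, D.head e ∈ X)
    (hδ : D.edgesInto univ X ⊆ M)
    (hψ : ∀ e ∈ M, D.tail e ∈ X → ψ e ∈ M ∧ D.head (ψ e) = D.tail e)
    (hinj : InjOn ψ (M ∩ {e | D.tail e ∈ X}))
    (hterm : ∀ x ∈ M, ∃ e ∈ M, D.head e = v ∧
      ReflTransGen (fun a b => b ∈ M ∧ D.tail b ∈ X ∧ ψ b = a) x e) :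
    D.Linked G v X := by
  classical
  have hnext : ∀ x, ∃ z, x ∈ M → D.head x ≠ v → z ∈ M ∧ D.tail z ∈ X ∧ ψ z = x := by
    intro x
    by_cases hx : x ∈ M ∧ D.head x ≠ v
    · obtain ⟨e, -, hev, hxe⟩ := hterm x hx.1
      rcases ReflTransGen.cases_head hxe with rfl | ⟨z, hz, -⟩
      · exact absurd hev hx.2
      · exact ⟨z, fun _ _ => hz⟩
    · exact ⟨x, fun h1 h2 => absurd ⟨h1, h2⟩ hx⟩
  choose φ hφ using hnext
  refine ⟨fun e => if e ∈ M then φ e else e, fun e he => ?_, fun e he => ?_, fun e he => ?_,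
    fun e he => ?_, fun e he e' he' hee' => ?_, fun x hx hxm hxf => ?_⟩
  · split_ifs with heM
    exacts [hMG (hφ e heM he.2.2).1, he.1]
  · split_ifs with heM
    exacts [hMX _ (hφ e heM he.2.2).1, he.2.1]
  · split_ifs with heM
    · exact (hφ e heM he.2.2).2.1
    · by_contra htl
      exact heM (hδ ⟨trivial, htl, he.2.1⟩)
  · split_ifs with heM
    · obtain ⟨h1, h2, h3⟩ := hφ e heM he.2.2
      exact Or.inr (by rw [← (hψ _ h1 h2).2, h3])
    · exact Or.inl rfl
  · beta_reduce at hee'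
    split_ifs at hee' with h1 h2 h2
    · rw [← (hφ e h1 he.2.2).2.2, hee', (hφ e' h2 he'.2.2).2.2]
    · exact absurd (hee' ▸ (hφ e h1 he.2.2).1) h2
    · exact absurd (hee' ▸ (hφ e' h2 he'.2.2).1) h1
    · exact hee'
  · have hM : ∀ n, x n ∈ M := fun n => by
      by_contra hn
      have := hxf n
      rw [if_neg hn] at this
      exact absurd (hx this) (by omega)
    have hsucc : ∀ n, x (n + 1) = φ (x n) := fun n => by rw [hxf n, if_pos (hM n)]
    obtain ⟨e, -, hev, hxe⟩ := hterm (x 0) (hM 0)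
    suffices H : ∀ y, ReflTransGen (fun a b => b ∈ M ∧ D.tail b ∈ X ∧ ψ b = a) y e →
        ∀ n, x n ≠ y from H _ hxe 0 rfl
    intro y hye
    induction hye using ReflTransGen.head_induction_on with
    | refl => exact fun n hn => (hxm n).2.2 (hn ▸ hev)
    | @head a c hac _ ih =>
      rintro n rfl
      obtain ⟨h1, h2, h3⟩ := hφ _ (hM n) (hxm n).2.2
      refine ih (n + 1) ?_
      rw [hsucc]
      exact hinj ⟨h1, h2⟩ ⟨hac.1, hac.2.1⟩ (h3.trans hac.2.2.symm)

theorem exists_good (h : WellFounded D.Step) (hF : D.IsFlame r F) (hvr : v ≠ r)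
    (hFK : ∀ e ∈ F, D.Lt (D.head e) v → e ∈ K)
    (hG : G = K ∪ {e | D.head e = v}) (hrX : r ∉ X) (hvX : v ∈ X) (hle : ∀ x ∈ X, D.Le x v)
    (hδ : D.edgesInto univ X ⊆ G) (hX : D.Linked G v X)
    (hinj : InjOn g {e | e ∈ G ∧ D.tail e ∉ X ∧ D.tail e ≠ r})
    (hmaps : MapsTo g {e | e ∈ G ∧ D.tail e ∉ X ∧ D.tail e ≠ r}
      {e | e ∈ G ∧ D.tail e ∉ X ∧ D.head e ∉ X})
    (hadj : ∀ e ∈ {e | e ∈ G ∧ D.tail e ∉ X ∧ D.tail e ≠ r}, g e = e ∨ D.head (g e) = D.tail e) :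
    ∃ I, D.Good r F K v I X := by
  classical
  obtain ⟨f, hf⟩ := hX
  obtain ⟨-, Ps, hPs, hdisj, hcov⟩ := hF.2.2 v hvr
  obtain ⟨π, hπ, hπinj⟩ := exists_pred_of_paths h hPs hdisj
  set B : Set E := {e | ∃ p ∈ Ps, e ∈ p}
  have hXr : ∀ {e}, D.tail e ∈ X → D.tail e ≠ r := fun he her => hrX (her ▸ he)
  have hBle : ∀ e ∈ B, e ∈ F ∧ D.Le (D.head e) v := by
    rintro e ⟨p, hp, hep⟩
    exact ⟨(hPs p hp).2.2.2.2.2 e hep, (hPs p hp).head_le hep⟩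
  obtain ⟨M, ψ, hMG, hMX, hδM, hAM, hψ, hψinj, hterm⟩ :=
    hf.exists_combine (A := D.delta F v) (B := B) (π := π) h hδ hvX
      (fun e he => hcov e ⟨he.1, he.2⟩)
      (fun e he => he.2) (fun e he => by
        rw [hG]
        rcases le_iff.1 (hBle e he).2 with hev | hev
        · exact Or.inr hev
        · exact Or.inl (hFK e (hBle e he).1 hev))
      (fun e he => Lt.ne h (TransGen.trans_left (D.lt_edge e) (hBle e he).2))
      (fun e he hX => hπ e he (hXr hX)) (hπinj.mono (fun e he => And.intro he.1 (hXr he.2)))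
  set O : Set E := {e | e ∈ G ∧ D.tail e ∉ X ∧ D.head e ∉ X ∧ (D.tail e = r ∨ g e ≠ e)}
  set I : Set E := {e | e ∈ M ∧ D.head e = v}
  have hMI : M ⊆ K ∪ I := fun e he => by
    rcases hG ▸ hMG he with h1 | h1
    exacts [Or.inl h1, Or.inr ⟨he, h1⟩]
  have hOK : O ⊆ K := fun e he => by
    rcases hG ▸ he.1 with h1 | h1
    exacts [h1, absurd (h1 ▸ hvX) he.2.2.1]
  have hR : ∀ e ∈ M ∪ O, D.tail e ≠ r → D.tail e ∉ X →
      e ∈ {e | e ∈ G ∧ D.tail e ∉ X ∧ D.tail e ≠ r} ∧ g e ∈ O ∧ D.head (g e) = D.tail e := by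
    intro e he her heX
    have heR : e ∈ {e | e ∈ G ∧ D.tail e ∉ X ∧ D.tail e ≠ r} :=
      ⟨he.elim (fun h => hMG h) (fun h => h.1), heX, her⟩
    have hge : g e ≠ e := by
      intro heq
      rcases he with he | he
      · exact (hmaps heR).2.2 (heq.symm ▸ hMX e he)
      · exact he.2.2.2.elim her (fun h => h heq)
    obtain ⟨h1, h2, h3⟩ := hmaps heR
    refine ⟨heR, ⟨h1, h2, h3, ?_⟩, (hadj e heR).resolve_left hge⟩
    by_contra! hcon
    exact hge (hinj ⟨h1, h2, hcon.1⟩ heR hcon.2)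
  have hMO : ∀ {e}, e ∈ M ∪ O → D.tail e ∈ X → e ∈ M := fun he hX =>
    he.resolve_right fun hO => hO.2.1 hX
  have hpred : D.IsPred r (M ∪ O) (fun e => if D.tail e ∈ X then ψ e else g e) := by
    intro e he her
    beta_reduce
    split_ifs with heX
    · exact ⟨Or.inl (hψ e (hMO he heX) heX).1, (hψ e (hMO he heX) heX).2⟩
    · exact ⟨Or.inr (hR e he her heX).2.1, (hR e he her heX).2.2⟩
  have hterm' : ∀ x ∈ M, ∃ e ∈ M ∪ O, D.head e = v ∧ ReflTransGen
      (D.PredRel r (M ∪ O) fun e => if D.tail e ∈ X then ψ e else g e) x e := by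
    intro x hx
    obtain ⟨e, he, hev, hxe⟩ := hterm x hx
    refine ⟨e, Or.inl he, hev, ReflTransGen.mono ?_ _ _ hxe⟩
    rintro a b ⟨hb, hbX, hab⟩
    exact ⟨Or.inl hb, hXr hbX, (if_pos hbX).trans hab⟩
  obtain ⟨Qs, hQs, hQdisj, hQcov, hQX⟩ := hpred.exists_paths (v := v) (X := X) h (by
    rintro e ⟨he, her⟩ e' ⟨he', her'⟩ hee'
    beta_reduce at hee'
    split_ifs at hee' with h1 h2 h2
    · exact hψinj ⟨hMO he h1, h1⟩ ⟨hMO he' h2, h2⟩ hee'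
    · have h3 := (hψ e (hMO he h1) h1).2
      rw [hee', (hR e' he' her' h2).2.2] at h3
      exact absurd (h3 ▸ h1) h2
    · have h3 := (hψ e' (hMO he' h2) h2).2
      rw [← hee', (hR e he her h1).2.2] at h3
      exact absurd (h3 ▸ h2) h1
    · exact hinj (hR e he her h1).1 (hR e' he' her' h2).1 hee') hrX hvX
    (fun e he her heX => by
      rw [if_neg heX]
      exact (hR e he her heX).2.1.2.1) (fun c hc => hterm' c (hδM hc))
  refine ⟨I, fun e he => he.2, fun e he => ⟨hAM he, he.2⟩, hrX, hvX, hle,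
    fun e he => hMI (hδM he), linked_of_pred hMI hMX hδM hψ hψinj hterm, Qs, fun p hp => ?_, hQdisj,
    fun e he => hQcov e (Or.inl he.1) he.2, hQX⟩
  exact (hQs p hp).mono fun e _ he => he.elim (fun h => hMI h) fun h => Or.inl (hOK h)

end MultiDigraph

namespace MultiDigraph

open Function Set Relation

variable {V : Type v} {E : Type u} {D : MultiDigraph V E} {F K : Set E} {r v : V}

theorem exists_good_of_lt (h : WellFounded D.Step) (hF : D.IsFlame r F) (hvr : v ≠ r)
    (hK : ∀ e ∈ K, D.Lt (D.head e) v) (hFK : ∀ e ∈ F, D.Lt (D.head e) v → e ∈ K)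
    (hprev : ∀ w, D.Lt w v → w ≠ r → ∃ X, r ∉ X ∧ w ∈ X ∧ (∀ x ∈ X, D.Le x w) ∧
      D.edgesInto univ X ⊆ K ∧ D.Linked {e | e ∈ K ∧ D.Le (D.head e) w} w X) :
    ∃ I X, D.Good r F K v I X := by
  set G : Set E := K ∪ {e | D.head e = v}
  set X : Set V := ⋃ Z : {Z : Set V // D.Linked G v Z ∧ (∀ x ∈ Z, D.Le x v) ∧ r ∉ Z}, Z.1
  have hX : D.Linked G v X := linked_iUnion fun Z => Z.2.1
  have hmax : ∀ Z, D.Linked G v Z → (∀ x ∈ Z, D.Le x v) → r ∉ Z → Z ⊆ X :=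
    fun Z h1 h2 h3 => subset_iUnion (fun Z : {Z : Set V // D.Linked G v Z ∧
      (∀ x ∈ Z, D.Le x v) ∧ r ∉ Z} => Z.1) ⟨Z, h1, h2, h3⟩
  have hle : ∀ x ∈ X, D.Le x v := fun x hx => by
    obtain ⟨Z, hZ⟩ := mem_iUnion.1 hx
    exact Z.2.2.1 x hZ
  have hrX : r ∉ X := fun hr => by
    obtain ⟨Z, hZ⟩ := mem_iUnion.1 hr
    exact Z.2.2.2 hZ
  have hvX : v ∈ X := hmax {v} (D.linked_singleton G v)
    (fun x hx => by rw [mem_singleton_iff.1 hx]; exact .refl) (fun hr => hvr hr.symm) rfl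
  have hδ : D.edgesInto univ X ⊆ G := by
    rintro e ⟨-, htl, hhd⟩
    by_cases hev : D.head e = v
    · exact Or.inr hev
    have hlt : D.Lt (D.head e) v := (le_iff.1 (hle _ hhd)).resolve_left hev
    obtain ⟨Z, hrZ, hwZ, hZle, hZK, hZ⟩ := hprev (D.head e) hlt fun hr => hrX (hr ▸ hhd)
    have hZG : D.Linked G (D.head e) Z := by
      refine hZ.of_subset (fun b hb => Or.inl hb.1) fun b hb hbZ _ => ⟨?_, hZle _ hbZ⟩
      refine hb.resolve_right fun hbv => lt_irrefl h v ?_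
      exact TransGen.trans_right (hbv ▸ hZle _ hbZ) hlt
    have hsub : X ∪ Z ⊆ X := hmax _ (hX.union hhd hZG)
      (fun x hx => hx.elim (hle x) fun hx => ReflTransGen.trans (hZle x hx) hlt.le)
      fun hr => hr.elim hrX hrZ
    exact Or.inl (hZK ⟨trivial, fun hZt => htl (hsub (Or.inr hZt)), hwZ⟩)
  obtain ⟨g, hinj, hmaps, hadj⟩ := Wave.exists_matching
    (N := fun e => {b | b = e ∨ D.head b = D.tail e})
    (R := {e | e ∈ G ∧ D.tail e ∉ X ∧ D.tail e ≠ r})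
    (L := {e | e ∈ G ∧ D.tail e ∉ X ∧ D.head e ∉ X}) (fun e => Or.inl rfl) (by
      rintro ⟨P, f, a, hw, ha, -⟩
      have hsub : X ∪ D.tail '' P ⊆ X := by
        refine hmax _ (hX.union_of_isWave hw) ?_ ?_
        · rintro x (hx | ⟨b, hb, rfl⟩)
          · exact hle x hx
          · rcases (hw.sub hb).1 with hbK | hbv
            · exact Lt.le (TransGen.trans (D.lt_edge b) (hK b hbK))
            · exact Lt.le (hbv ▸ D.lt_edge b)
        · rintro (hr | ⟨b, hb, hbr⟩)
          exacts [hrX hr, (hw.sub hb).2.2 hbr]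
      exact (hw.sub ha).2.1 (hsub (Or.inr ⟨a, ha, rfl⟩)))
  obtain ⟨I, hI⟩ := exists_good h hF hvr hFK rfl hrX hvX hle hδ hX hinj hmaps hadj
  exact ⟨I, X, hI⟩

/-- The edges entering vertices below `v` which are selected by `d`. -/
def below (D : MultiDigraph V E) (d : V → Set E × Set V) (v : V) : Set E :=
  {e | D.Lt (D.head e) v ∧ e ∈ (d (D.head e)).1}

theorem exists_good_family (h : WellFounded D.Step) (hroot : ∀ e, D.head e ≠ r)
    (hF : D.IsFlame r F) :
    ∃ d : V → Set E × Set V, ∀ v, v ≠ r → D.Good r F (D.below d v) v (d v).1 (d v).2 := by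
  refine exists_rec_of_locallyExtendable (wellFounded_lt h)
    (fun v d a => v ≠ r → D.Good r F (D.below d v) v a.1 a.2) ?_ TransGen.trans ?_
  · intro v d d' a hdd' hg hvr
    have : D.below d' v = D.below d v := by
      ext e
      refine and_congr_right fun hlt => ?_
      rw [hdd' _ hlt]
    rw [this]
    exact hg hvr
  · intro v d hd
    by_cases hvr : v = r
    · exact ⟨(∅, ∅), fun h => absurd hvr h⟩
    obtain ⟨I, X, hg⟩ := exists_good_of_lt (K := D.below d v) h hF hvr (fun e he => he.1)
      (fun e he hlt => ⟨hlt, (hd _ hlt (hroot e)).delta_subset ⟨he, rfl⟩⟩) fun w hwv hwr => by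
        have hg := hd w hwv hwr
        have hsub : D.below d w ∪ (d w).1 ⊆ {e | e ∈ D.below d v ∧ D.Le (D.head e) w} := by
          rintro e (he | he)
          · exact ⟨⟨TransGen.trans he.1 hwv, he.2⟩, he.1.le⟩
          · have hew := hg.head_eq e he
            exact ⟨⟨hew ▸ hwv, by rwa [hew]⟩, hew ▸ .refl⟩
        refine ⟨(d w).2, hg.root_notMem, hg.mem, hg.le, fun e he =>
          (hsub (hg.edgesInto_subset he)).1, hg.linked.of_subset hsub fun e he _ hne => ?_⟩
        exact Or.inl ⟨(le_iff.1 he.2).resolve_left hne, he.1.2⟩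
    exact ⟨(I, X), fun _ => hg⟩

theorem exists_large_flame (h : WellFounded D.Step) (hroot : ∀ e, D.head e ≠ r)
    (hF : D.IsFlame r F) : ∃ L : Set E, F ⊆ L ∧ D.IsFlame r L ∧ D.Large r L := by
  obtain ⟨d, hd⟩ := exists_good_family h hroot hF
  set L : Set E := {e | e ∈ (d (D.head e)).1}
  have hL : ∀ v, v ≠ r → D.below d v ∪ (d v).1 ⊆ L := by
    rintro v hvr e (he | he)
    · exact he.2
    · change e ∈ (d (D.head e)).1
      rwa [(hd v hvr).head_eq e he]
  refine ⟨L, fun e he => (hd _ (hroot e)).delta_subset ⟨he, rfl⟩,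
    ⟨Subset.rfl, fun e _ => hroot e, fun v hvr => ⟨Subset.rfl, ?_⟩⟩, fun v hvr => ?_⟩
  · obtain ⟨Ps, hPs, hdisj, hcov, -⟩ := (hd v hvr).exists_paths
    refine ⟨Ps, fun p hp => (hPs p hp).mono fun e _ he => hL v hvr he, hdisj, ?_⟩
    rintro e ⟨he, rfl⟩
    exact hcov e he
  · obtain ⟨Ps, hPs, hdisj, -, htr⟩ := (hd v hvr).exists_paths
    exact ⟨Ps, _, fun p hp => (hPs p hp).mono fun e _ he => hL v hvr he, hdisj, htr,
      fun p hp => hp.exists_mem_edgesInto (hd v hvr).root_notMem (hd v hvr).mem⟩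

end MultiDigraph

/-- In every acyclic `r`-rooted digraph without backward-infinite
paths, every flame extends to a large flame. -/
theorem stmt1 {V E : Type*} (D : MultiDigraph V E) (r : V)
    (hroot : ∀ e, D.head e ≠ r)
    (hacyclic : ¬ D.HasCycle)
    (hnoback : ¬ D.HasBackwardInfinitePath)
    (F : Set E) (hF : D.IsFlame r F) :
    ∃ L : Set E, F ⊆ L ∧ D.IsFlame r L ∧ D.Large r L := by
  exact MultiDigraph.exists_large_flame
    (MultiDigraph.wellFounded_step hacyclic hnoback) hroot hF
end

section
/- Let D = (V,E) be an r-rooted digraph (possibly infinite) and let v, w ∈ V \ {r}. If X is v-linked, w ∈ X, and Y is w-linked, then X ∪ Y is v-linked. -/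
namespace MultiDigraph

variable {V E : Type*}

/-- A walk ending in `X` no edge of which, except possibly the first, enters `X` has all its heads
and all its tails, except possibly the first, in `X`. -/
theorem head_mem_of_isChain (D : MultiDigraph V E) {X : Set V} :
    ∀ (e : E) (l : List E), (e :: l).IsChain (fun e f => D.head e = D.tail f) →
      D.head ((e :: l).getLast (List.cons_ne_nil e l)) ∈ X →
      (∀ a ∈ l, a ∉ D.edgesInto Set.univ X) →
      D.head e ∈ X ∧ ∀ a ∈ l, D.head a ∈ X ∧ D.tail a ∈ X
  | e, [], _, hlast, _ => ⟨by simpa using hlast, by simp⟩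
  | e, b :: l, hchain, hlast, hno => by
    rw [List.isChain_cons_cons] at hchain
    obtain ⟨hb, hl⟩ := D.head_mem_of_isChain b l hchain.2 (by simpa using hlast)
      (fun a ha => hno a (List.mem_cons_of_mem _ ha))
    have htail : D.tail b ∈ X := by
      by_contra h
      exact hno b List.mem_cons_self ⟨trivial, h, hb⟩
    refine ⟨hchain.1 ▸ htail, fun a ha => ?_⟩
    rcases List.mem_cons.1 ha with rfl | ha
    · exact ⟨hb, htail⟩
    · exact hl a ha

/-- In a linkage of `X`, the path starting with `e` stays inside `X` after `e`. -/
theorem linkage_eq_cons (D : MultiDigraph V E) {X : Set V} {v : V} (hv : v ∈ X) {P : E → List E}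
    (hP : ∀ e ∈ D.edgesInto Set.univ X,
      D.IsPathIn Set.univ (D.tail e) v (P e) ∧ (P e).head? = some e)
    (hdisj : (D.edgesInto Set.univ X).Pairwise (fun e f => (P e).Disjoint (P f)))
    {e : E} (he : e ∈ D.edgesInto Set.univ X) :
    ∃ l, P e = e :: l ∧ ∀ a ∈ l, D.head a ∈ X ∧ D.tail a ∈ X := by
  obtain ⟨⟨hne, -, hlast, hchain, hnd, -⟩, hhead⟩ := hP e he
  obtain ⟨l, hl⟩ := List.head?_eq_some_iff.1 hhead
  refine ⟨l, hl, ?_⟩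
  simp only [hl] at hlast hchain hnd
  refine (D.head_mem_of_isChain e l hchain (hlast ▸ hv) fun a ha haX => ?_).2
  obtain rfl | hne := eq_or_ne a e
  · simp only [List.map_cons, List.nodup_cons] at hnd
    exact hnd.2.1 (List.mem_map_of_mem ha)
  · refine hdisj haX he hne (List.mem_of_mem_head? (hP a haX).2) ?_
    rw [hl]
    exact List.mem_cons_of_mem _ ha

end MultiDigraph

/-- Splitting a list at the first element satisfying a predicate. -/
theorem List.exists_eq_append_cons_of_exists_mem {α : Type*} {p : α → Prop} :
    ∀ {l : List α}, (∃ a ∈ l, p a) → ∃ s a t, l = s ++ a :: t ∧ p a ∧ ∀ b ∈ s, ¬ p b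
  | [], h => by simp at h
  | a :: l, h => by
    by_cases ha : p a
    · exact ⟨[], a, l, rfl, ha, by simp⟩
    · obtain ⟨s, b, t, rfl, hb, hs⟩ :=
        List.exists_eq_append_cons_of_exists_mem (l := l) (p := p) (by simpa [ha] using h)
      exact ⟨a :: s, b, t, rfl, hb, by simpa [ha] using hs⟩

/-- If `X` is `v`-linked, `w ∈ X`, and `Y` is `w`-linked, then
`X ∪ Y` is `v`-linked. -/
theorem stmt3 {V E : Type*} (D : MultiDigraph V E) (r : V)
    (hroot : ∀ e, D.head e ≠ r)
    (v w : V) (hv : v ≠ r) (hw : w ≠ r)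
    (X Y : Set V)
    (hX : D.VLinked Set.univ r v X)
    (hwX : w ∈ X)
    (hY : D.VLinked Set.univ r w Y) :
    D.VLinked Set.univ r v (X ∪ Y) := by
  obtain ⟨hrX, hvX, P, hP, hPd⟩ := hX
  obtain ⟨hrY, hwY, Q, hQ, hQd⟩ := hY
  -- Every edge `e` entering `X ∪ Y` is continued by an initial segment `A e` of `Q e` avoiding `X`
  -- up to an edge `g e` entering `X`.
  have hseg : ∀ e, ∃ (A : List E) (g : E), e ∈ D.edgesInto Set.univ (X ∪ Y) →
      g ∈ D.edgesInto Set.univ X ∧ (A ++ [g]).IsChain (fun e f => D.head e = D.tail f) ∧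
      (A ++ [g]).head? = some e ∧ (∀ a ∈ A, D.head a ∉ X) ∧
      (D.tail e :: A.map D.head).Nodup ∧
      ((A = [] ∧ g = e) ∨ (A ++ [g] ⊆ Q e ∧ e ∈ D.edgesInto Set.univ Y ∧ D.tail g ∈ Y)) := by
    intro e
    by_cases he : e ∈ D.edgesInto Set.univ (X ∪ Y)
    swap
    · exact ⟨[], e, fun h => absurd h he⟩
    obtain ⟨-, htail, hhead⟩ := id he
    rw [Set.mem_union, not_or] at htail
    by_cases hX : D.head e ∈ X
    · exact ⟨[], e, fun _ => ⟨⟨trivial, htail.1, hX⟩, by simp, by simp, by simp, by simp,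
        Or.inl ⟨rfl, rfl⟩⟩⟩
    have heY : e ∈ D.edgesInto Set.univ Y := ⟨trivial, htail.2, hhead.resolve_left hX⟩
    obtain ⟨l, hl, hlY⟩ := D.linkage_eq_cons hwY hQ hQd heY
    obtain ⟨⟨hne, -, hlast, hchain, hnd, -⟩, -⟩ := hQ e heY
    have hex : ∃ a ∈ l, D.head a ∈ X := by
      have : ∃ a ∈ Q e, D.head a ∈ X := ⟨_, List.getLast_mem hne, hlast ▸ hwX⟩
      simpa [hl, hX] using this
    obtain ⟨s, g, t, rfl, hg, hs⟩ := List.exists_eq_append_cons_of_exists_mem hex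
    have hsplit : Q e = ((e :: s) ++ [g]) ++ t := by simp [hl]
    have hsX : ∀ a ∈ e :: s, D.head a ∉ X := by simpa [hX] using hs
    rw [hsplit] at hchain hnd
    have hch := hchain.left_of_append
    refine ⟨e :: s, g, fun _ => ⟨⟨trivial, ?_, hg⟩, hch, by simp, hsX, ?_, Or.inr ⟨?_, heY, ?_⟩⟩⟩
    · rw [← (List.isChain_append.1 hch).2.2 _ (List.getLast_mem_getLast? (List.cons_ne_nil e s)) g
        (by simp)]
      exact hsX _ (List.getLast_mem _)
    · refine hnd.sublist (List.Sublist.cons_cons _ (List.Sublist.map _ ?_))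
      rw [List.append_assoc]
      exact List.sublist_append_left _ _
    · rw [hsplit]
      exact List.subset_append_left _ _
    · exact (hlY g (by simp)).2
  choose A g hA using hseg
  have hPX : ∀ f ∈ D.edgesInto Set.univ X, ∀ a ∈ P f, D.head a ∈ X := by
    intro f hf a ha
    obtain ⟨l, hl, hlX⟩ := D.linkage_eq_cons hvX hP hPd hf
    rw [hl, List.mem_cons] at ha
    rcases ha with rfl | ha
    · exact hf.2.2
    · exact (hlX a ha).1
  refine ⟨by simp [hrX, hrY], Or.inl hvX, fun e => A e ++ P (g e), fun e he => ?_,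
    fun e he f hf hef => ?_⟩
  · obtain ⟨hg, hch, hhd, hAX, hnd, -⟩ := hA e he
    obtain ⟨⟨hne, -, hlast, hchain, hPnd, -⟩, hhead⟩ := hP (g e) hg
    have hhead' : (A e ++ P (g e)).head? = some e := by
      rw [List.head?_append] at hhd ⊢
      rw [hhead]
      simpa using hhd
    refine ⟨⟨by simp [hne], ?_, ?_, ?_, ?_, fun _ _ => trivial⟩, hhead'⟩
    · rw [(List.head_eq_iff_head?_eq_some _).2 hhead']
    · rw [List.getLast_append_of_ne_nil _ hne, hlast]
    · rw [List.isChain_append] at hch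
      refine List.isChain_append.2 ⟨hch.1, hchain, fun a ha b hb => hch.2.2 a ha b ?_⟩
      rw [hhead] at hb
      simpa using hb
    · rw [List.map_append, ← List.cons_append]
      refine hnd.append (List.nodup_cons.1 hPnd).2 fun x hx hx' => ?_
      obtain ⟨b, hb, rfl⟩ := List.mem_map.1 hx'
      have hbX := hPX _ hg b hb
      rcases List.mem_cons.1 hx with h | h
      · exact he.2.1 (Or.inl (h ▸ hbX))
      · obtain ⟨a, ha, hab⟩ := List.mem_map.1 h
        exact hAX a ha (hab ▸ hbX)
  · obtain ⟨hge, -, -, hAe, -, hce⟩ := hA e he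
    obtain ⟨hgf, -, -, hAf, -, hcf⟩ := hA f hf
    have hgne : g e ≠ g f := by
      rcases hce with ⟨-, h⟩ | ⟨hse, heY, hte⟩ <;> rcases hcf with ⟨-, h'⟩ | ⟨hsf, hfY, htf⟩
      · rwa [h, h']
      · rw [h]
        rintro h'
        exact he.2.1 (Or.inr (h' ▸ htf))
      · rw [h']
        rintro h
        exact hf.2.1 (Or.inr (h ▸ hte))
      · intro h
        exact hQd heY hfY hef (hse List.mem_concat_self) (h ▸ hsf List.mem_concat_self)
    intro a ha ha'
    rcases List.mem_append.1 ha with ha | ha <;> rcases List.mem_append.1 ha' with ha' | ha'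
    · rcases hce with ⟨h, -⟩ | ⟨hse, heY, -⟩
      · simp [h] at ha
      rcases hcf with ⟨h, -⟩ | ⟨hsf, hfY, -⟩
      · simp [h] at ha'
      exact hQd heY hfY hef (hse (List.mem_append_left _ ha)) (hsf (List.mem_append_left _ ha'))
    · exact hAe a ha (hPX _ hgf a ha')
    · exact hAf a ha' (hPX _ hge a ha)
    · exact hPd hge hgf hgne ha ha'
end

section
/- Let D = (V,E) be an r-rooted digraph (possibly infinite) and v ∈ V \ {r}, and let X_{v,D} denote the ⊆-largest v-linked set in D. Then for every w ∈ X_{v,D} with w ≠ r, we have X_{w,D} ⊆ X_{v,D}. -/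
namespace MultiDigraph

variable {V E : Type*}

/-- A directed walk ending in `X` none of whose edges enters `X` stays inside `X`. -/
theorem mem_of_chain_of_not_enter (D : MultiDigraph V E) (X : Set V) (l : List E)
    (hc : l.IsChain (fun e f => D.head e = D.tail f))
    (hlast : ∀ e, l.getLast? = some e → D.head e ∈ X)
    (hno : ∀ e ∈ l, D.head e ∈ X → D.tail e ∈ X) :
    ∀ e ∈ l, D.tail e ∈ X ∧ D.head e ∈ X := by
  induction l with
  | nil => simp
  | cons a l ih =>
    cases l with
    | nil =>
      have ha : D.head a ∈ X := hlast a (by simp)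
      simpa using ⟨hno a (by simp) ha, ha⟩
    | cons b l =>
      rw [List.isChain_cons_cons] at hc
      have ih' := ih hc.2 (fun e he => hlast e (by simpa using he))
        (fun e he => hno e (List.mem_cons_of_mem _ he))
      have ha : D.head a ∈ X := hc.1 ▸ (ih' b (by simp)).1
      intro e he
      rcases List.mem_cons.1 he with rfl | he
      · exact ⟨hno e (by simp) ha, ha⟩
      · exact ih' e he

/-- The paths witnessing that `X` is `v`-linked never leave `X` after their initial edge. -/
theorem exists_tail_inside_of_linked (D : MultiDigraph V E) {L : Set E} {X : Set V} {v : V}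
    (hv : v ∈ X) {P : E → List E}
    (hP : ∀ e ∈ D.edgesInto L X, D.IsPathIn L (D.tail e) v (P e) ∧ (P e).head? = some e)
    (hdisj : (D.edgesInto L X).Pairwise (fun e f => (P e).Disjoint (P f)))
    {e : E} (he : e ∈ D.edgesInto L X) :
    ∃ l, P e = e :: l ∧ ∀ g ∈ l, D.tail g ∈ X ∧ D.head g ∈ X := by
  obtain ⟨⟨hne, -, hlast, hc, hnd, hL⟩, hhead⟩ := hP e he
  obtain ⟨l, hl⟩ : ∃ l, P e = e :: l := by
    cases h : P e with
    | nil => exact absurd h hne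
    | cons a l => rw [h] at hhead; simp at hhead; exact ⟨l, by rw [hhead]⟩
  refine ⟨l, hl, D.mem_of_chain_of_not_enter X l ?_ ?_ ?_⟩
  · rw [hl] at hc
    exact List.IsChain.tail hc
  · intro g hg
    have : (P e).getLast? = some g := by
      rw [hl, List.getLast?_cons, hg]; rfl
    rw [List.getLast?_eq_some_getLast hne, Option.some_inj] at this
    rw [← this, hlast]
    exact hv
  · intro g hg hgX
    by_contra hgt
    have hgP : g ∈ P e := hl ▸ List.mem_cons_of_mem _ hg
    have hgI : g ∈ D.edgesInto L X := ⟨hL g hgP, hgt, hgX⟩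
    have hge : e ≠ g := by
      rintro rfl
      rw [hl] at hnd
      have := (List.nodup_cons.1 hnd).2
      simp only [List.map_cons, List.nodup_cons] at this
      exact this.1 (List.mem_map_of_mem hg)
    exact hdisj he hgI hge hgP (List.mem_of_mem_head? (hP g hgI).2)

/-- A list with an element satisfying `p` splits at the first such element. -/
theorem exists_split_first {α : Type*} (p : α → Prop) (l : List α) (h : ∃ a ∈ l, p a) :
    ∃ a f b, l = a ++ f :: b ∧ p f ∧ ∀ g ∈ a, ¬ p g := by
  induction l with
  | nil => simp at h
  | cons x l ih =>
    by_cases hx : p x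
    · exact ⟨[], x, l, rfl, hx, by simp⟩
    · obtain ⟨a, f, b, rfl, hf, ha⟩ := ih (by simpa [hx] using h)
      exact ⟨x :: a, f, b, rfl, hf, by simpa [hx] using ha⟩

/-- If `X` is `v`-linked, `Y` is `w`-linked and `w ∈ X`, then `X ∪ Y` is `v`-linked. -/
theorem VLinked.union (D : MultiDigraph V E) {L : Set E} {r v w : V} {X Y : Set V}
    (hX : D.VLinked L r v X) (hY : D.VLinked L r w Y) (hw : w ∈ X) :
    D.VLinked L r v (X ∪ Y) := by
  obtain ⟨hrX, hvX, P, hP, hPd⟩ := hX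
  obtain ⟨hrY, hwY, Q, hQ, hQd⟩ := hY
  refine ⟨by simp [hrX, hrY], Or.inl hvX, ?_⟩
  have key : ∀ e, ∃ (a : List E) (f : E), e ∈ D.edgesInto L (X ∪ Y) →
      (a ++ [f]).head? = some e ∧
      (a ++ [f]).IsChain (fun e f => D.head e = D.tail f) ∧
      (D.tail e :: a.map D.head).Nodup ∧
      (∀ g ∈ a, g ∈ L ∧ D.head g ∉ X) ∧
      f ∈ D.edgesInto L X ∧
      (∀ g ∈ a ++ [f], g = e ∨ (e ∈ D.edgesInto L Y ∧ g ∈ Q e ∧ D.tail g ∈ Y)) := by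
    intro e
    by_cases he : e ∈ D.edgesInto L (X ∪ Y)
    swap
    · exact ⟨[], e, fun h => absurd h he⟩
    obtain ⟨heL, het, heh⟩ := he
    have hetX : D.tail e ∉ X := fun h => het (Or.inl h)
    have hetY : D.tail e ∉ Y := fun h => het (Or.inr h)
    by_cases heX : D.head e ∈ X
    · exact ⟨[], e, fun _ => ⟨rfl, by simp, by simp, by simp, ⟨heL, hetX, heX⟩, by simp⟩⟩
    have heY : e ∈ D.edgesInto L Y := ⟨heL, hetY, heh.resolve_left heX⟩
    obtain ⟨l, hl, hlY⟩ := D.exists_tail_inside_of_linked hwY hQ hQd heY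
    obtain ⟨⟨hne, -, hlast, hc, hnd, hL⟩, -⟩ := hQ e heY
    obtain ⟨a, f, b, hab, hf, ha⟩ := exists_split_first (fun g => D.head g ∈ X) (Q e)
      ⟨_, List.getLast_mem hne, by rw [hlast]; exact hw⟩
    cases a with
    | nil =>
      rw [hl] at hab
      simp only [List.nil_append, List.cons.injEq] at hab
      exact absurd (hab.1 ▸ hf) heX
    | cons x a =>
      have hxe : e = x := by
        rw [hl] at hab
        simp only [List.cons_append, List.cons.injEq] at hab
        exact hab.1
      subst hxe
      have hlab : l = a ++ f :: b := by simpa [hl] using hab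
      have hc' : (e :: a ++ [f]).IsChain (fun e f => D.head e = D.tail f) := by
        have : Q e = (e :: a ++ [f]) ++ b := by simp [hab]
        exact List.IsChain.left_of_append (this ▸ hc)
      have hft : D.tail f ∉ X := by
        obtain ⟨-, -, h⟩ := List.isChain_append.1 hc'
        have := h _ (List.getLast?_eq_some_getLast (by simp)) f (by simp)
        rw [← this]
        exact ha _ (List.getLast_mem _)
      refine ⟨e :: a, f, fun _ => ⟨rfl, hc', ?_, ?_, ⟨hL f (by simp [hab]), hft, hf⟩, ?_⟩⟩
      · rw [hab, List.map_append, ← List.cons_append] at hnd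
        exact (List.nodup_append.1 hnd).1
      · exact fun g hg => ⟨hL g (hab ▸ List.mem_append_left _ hg), ha g hg⟩
      · intro g hg
        rw [List.cons_append, List.mem_cons] at hg
        rcases hg with hg | hg
        · exact Or.inl hg
        · have hgl : g ∈ l := by
            rw [hlab]
            simp only [List.mem_append, List.mem_cons, List.not_mem_nil, or_false] at hg ⊢
            tauto
          exact Or.inr ⟨heY, hl ▸ List.mem_cons_of_mem _ hgl, (hlY g hgl).1⟩
  choose A F hAF using key
  have hAd : ∀ e ∈ D.edgesInto L (X ∪ Y), ∀ e' ∈ D.edgesInto L (X ∪ Y), e ≠ e' →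
      ∀ g ∈ A e ++ [F e], g ∉ A e' ++ [F e'] := by
    intro e he e' he' hne g hg hg'
    obtain ⟨-, -, -, -, -, h⟩ := hAF e he
    obtain ⟨-, -, -, -, -, h'⟩ := hAF e' he'
    rcases h g hg with rfl | ⟨h1, h2, h3⟩ <;> rcases h' g hg' with rfl | ⟨h1', h2', h3'⟩
    · exact hne rfl
    · exact he.2.1 (Or.inr h3')
    · exact he'.2.1 (Or.inr h3)
    · exact hQd h1 h1' hne h2 h2'
  have hPX : ∀ f ∈ D.edgesInto L X, ∀ g ∈ P f, D.head g ∈ X := by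
    intro f hf g hg
    obtain ⟨l, hl, hlX⟩ := D.exists_tail_inside_of_linked hvX hP hPd hf
    rw [hl, List.mem_cons] at hg
    rcases hg with rfl | hg
    · exact hf.2.2
    · exact (hlX g hg).2
  refine ⟨fun e => A e ++ P (F e), ?_, ?_⟩
  · intro e he
    obtain ⟨hhead, hc, hnd, hA, hF, -⟩ := hAF e he
    obtain ⟨⟨hne, -, hlast, hPc, hPnd, hPL⟩, hPhead⟩ := hP _ hF
    have hhead' : (A e ++ P (F e)).head? = some e := by
      rw [List.head?_append] at hhead ⊢
      rw [hPhead]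
      exact hhead
    have hne' : A e ++ P (F e) ≠ [] := by simp [hne]
    refine ⟨⟨hne', ?_, ?_, ?_, ?_, ?_⟩, hhead'⟩
    · rw [List.head?_eq_some_head hne', Option.some_inj] at hhead'
      rw [hhead']
    · rw [List.getLast_append_of_ne_nil _ hne, hlast]
    · obtain ⟨h1, -, h2⟩ := List.isChain_append.1 hc
      refine List.isChain_append.2 ⟨h1, hPc, fun x hx y hy => h2 x hx y ?_⟩
      rw [hPhead] at hy
      simpa using hy
    · rw [List.map_append, ← List.cons_append]
      refine List.nodup_append.2 ⟨hnd, (List.nodup_cons.1 hPnd).2, ?_⟩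
      rintro x hx y hy rfl
      obtain ⟨g, hg, rfl⟩ := List.mem_map.1 hy
      have hgX := hPX _ hF g hg
      rcases List.mem_cons.1 hx with hx | hx
      · exact he.2.1 (Or.inl (hx ▸ hgX))
      · obtain ⟨k, hk, hkg⟩ := List.mem_map.1 hx
        exact (hA k hk).2 (hkg ▸ hgX)
    · intro g hg
      rcases List.mem_append.1 hg with hg | hg
      · exact (hA g hg).1
      · exact hPL g hg
  · intro e he e' he' hne g hg hg'
    obtain ⟨-, -, -, hA, hF, -⟩ := hAF e he
    obtain ⟨-, -, -, hA', hF', -⟩ := hAF e' he'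
    rcases List.mem_append.1 hg with hg | hg <;> rcases List.mem_append.1 hg' with hg' | hg'
    · exact hAd e he e' he' hne g (List.mem_append_left _ hg) (List.mem_append_left _ hg')
    · exact (hA g hg).2 (hPX _ hF' g hg')
    · exact (hA' g hg').2 (hPX _ hF g hg)
    · have hFne : F e ≠ F e' := fun h =>
        hAd e he e' he' hne (F e) (by simp) (by simp [h])
      exact hPd hF hF' hFne hg hg'

end MultiDigraph

/-- If `Xv` is the `⊆`-largest `v`-linked set and `Xw` is the
`⊆`-largest `w`-linked set for some `w ∈ Xv`, `w ≠ r`, then `Xw ⊆ Xv`. -/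
theorem stmt6 {V E : Type*} (D : MultiDigraph V E) (r : V)
    (hroot : ∀ e, D.head e ≠ r)
    (v w : V) (hv : v ≠ r) (hw : w ≠ r)
    (Xv Xw : Set V)
    (hXv : D.VLinked Set.univ r v Xv)
    (hXvmax : ∀ X : Set V, D.VLinked Set.univ r v X → X ⊆ Xv)
    (hwXv : w ∈ Xv)
    (hXw : D.VLinked Set.univ r w Xw)
    (hXwmax : ∀ X : Set V, D.VLinked Set.univ r w X → X ⊆ Xw) :
    Xw ⊆ Xv := by
  exact Set.subset_union_right.trans (hXvmax _ (hXv.union D hXw hwXv))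
end
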